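/- Let s ≥ 2 be an integer, r_1,...,r_s real numbers each greater than 1 and none of them an integer, and λ ≥ 1 a real number such that 1/r_1 + ... + 1/r_{s−1} + 1/(λ r_s) = 1. Then S(x) ≪ x, where S(x) = Σ_{a_1, a_2 ∈ A, a_1 < a_2 ≤ x} #{(p_1, p_2) : p_1, p_2 prime, p_2 < p_1 ≤ x, p_1 − p_2 = a_2 − a_1}; that is, there exist C > 0 and x_0 such that S(x) ≤ C·x for all x ≥ x_0. -/

import Mathlib

/-- The set `A = { 2^⌊k_1^{r_1}⌋ + ... + 2^⌊k_{s-1}^{r_{s-1}}⌋ + 2^⌊⌊k_s^λ⌋^{r_s}⌋ }`,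
with `k_1, ..., k_s` ranging over positive integers (indices 0-based: the last index is
`s - 1`). -/
def romA (s : ℕ) (hs : 0 < s) (r : Fin s → ℝ) (lam : ℝ) : Set ℕ :=
  {n | ∃ k : Fin s → ℕ, (∀ i, 0 < k i) ∧
    n = (∑ i ∈ Finset.univ.filter (fun i : Fin s => (i : ℕ) < s - 1),
          2 ^ ⌊(k i : ℝ) ^ (r i)⌋₊)
      + 2 ^ ⌊((⌊(k ⟨s - 1, by omega⟩ : ℝ) ^ lam⌋₊ : ℕ) : ℝ) ^ (r ⟨s - 1, by omega⟩)⌋₊}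

section

open Finset

/-- The iterated forward difference of `f` with the steps in the list. -/
def iterDiff : List ℕ → (ℝ → ℝ) → ℝ → ℝ
  | [], f, x => f x
  | h :: hs, f, x => iterDiff hs f (x + h) - iterDiff hs f x

/-- The points of `Z` which stay in `Z` under all partial sums of the steps in the list. -/
def shiftSet (Z : Finset ℕ) : List ℕ → Finset ℕ
  | [] => Z
  | h :: hs => (shiftSet Z hs).filter (fun k => k + h ∈ shiftSet Z hs)

lemma hasDerivAt_iterDiff_rpow (hs : List ℕ) (β x : ℝ) (hx : 0 < x) :
    HasDerivAt (iterDiff hs (fun t => t ^ β)) (β * iterDiff hs (fun t => t ^ (β - 1)) x) x := by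
  induction hs generalizing x with
  | nil =>
    simpa [iterDiff] using Real.hasDerivAt_rpow_const (p := β) (Or.inl hx.ne')
  | cons h hs ih =>
    have h1 := (ih (x + h) (by positivity)).comp_add_const x (h : ℝ)
    have h2 := h1.sub (ih x hx)
    have h3 : β * iterDiff (h :: hs) (fun t => t ^ (β - 1)) x
        = β * iterDiff hs (fun t => t ^ (β - 1)) (x + h)
          - β * iterDiff hs (fun t => t ^ (β - 1)) x := by
      simp only [iterDiff]; ring
    rw [h3]
    exact h2

lemma exists_iterDiff_rpow_eq (hs : List ℕ) (β x : ℝ) (hx : 0 < x) :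
    ∃ ξ, x ≤ ξ ∧ ξ ≤ x + hs.sum ∧ iterDiff hs (fun t => t ^ β) x
      = (hs.prod : ℝ) * (∏ i ∈ range hs.length, (β - i)) * ξ ^ (β - hs.length) := by
  induction hs generalizing x β with
  | nil => exact ⟨x, le_rfl, by simp, by simp [iterDiff]⟩
  | cons h hs ih =>
    rcases Nat.eq_zero_or_pos h with rfl | hpos
    · exact ⟨x, le_rfl, le_add_of_nonneg_right (Nat.cast_nonneg _), by simp [iterDiff]⟩
    have hh : (0 : ℝ) < h := by exact_mod_cast hpos
    have hd : ∀ y, x ≤ y → HasDerivAt (iterDiff hs (fun t => t ^ β))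
        (β * iterDiff hs (fun t => t ^ (β - 1)) y) y :=
      fun y hy => hasDerivAt_iterDiff_rpow hs β y (hx.trans_le hy)
    obtain ⟨c, hc, hcs⟩ := exists_hasDerivAt_eq_slope (iterDiff hs (fun t => t ^ β))
      (fun y => β * iterDiff hs (fun t => t ^ (β - 1)) y) (lt_add_of_pos_right x hh)
      (fun y hy => (hd y hy.1).continuousAt.continuousWithinAt) (fun y hy => hd y hy.1.le)
    obtain ⟨ξ, h1, h2, h3⟩ := ih (β - 1) c (hx.trans hc.1)
    refine ⟨ξ, hc.1.le.trans h1, ?_, ?_⟩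
    · have := hc.2
      push_cast [List.sum_cons] at *
      linarith
    · have e : iterDiff (h :: hs) (fun t => t ^ β) x
          = h * (β * iterDiff hs (fun t => t ^ (β - 1)) c) := by
        simp only [iterDiff]
        rw [hcs, add_sub_cancel_left, mul_div_cancel₀ _ hh.ne']
      rw [e, h3, List.length_cons, prod_range_succ']
      have e2 : ∀ i ∈ range hs.length, β - 1 - (i : ℝ) = β - ((i + 1 : ℕ) : ℝ) := by
        intro i _; push_cast; ring
      rw [prod_congr rfl e2]
      have e3 : β - 1 - (hs.length : ℝ) = β - ((hs.length + 1 : ℕ) : ℝ) := by push_cast; ring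
      rw [e3]
      push_cast [List.prod_cons]
      ring

lemma shiftSet_subset (Z : Finset ℕ) (hs : List ℕ) {k : ℕ} (hk : k ∈ shiftSet Z hs) :
    k ∈ Z ∧ k + hs.sum ∈ Z := by
  induction hs generalizing k with
  | nil => simpa [shiftSet] using hk
  | cons h hs ih =>
    simp only [shiftSet, mem_filter] at hk
    refine ⟨(ih hk.1).1, ?_⟩
    have := (ih hk.2).2
    rwa [List.sum_cons, ← add_assoc]

lemma exists_near_multiple_of_mem_shiftSet (Z : Finset ℕ) (f : ℝ → ℝ) (m b : ℝ)
    (hZ : ∀ k ∈ Z, ∃ n : ℤ, |f k - b - m * n| ≤ 1) (hs : List ℕ) :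
    ∃ c : ℝ, ∀ k ∈ shiftSet Z hs, ∃ n : ℤ, |iterDiff hs f k - c - m * n| ≤ 2 ^ hs.length := by
  induction hs with
  | nil => exact ⟨b, by simpa [shiftSet, iterDiff] using hZ⟩
  | cons h hs ih =>
    obtain ⟨c, hc⟩ := ih
    refine ⟨0, fun k hk => ?_⟩
    simp only [shiftSet, mem_filter] at hk
    obtain ⟨n₁, h₁⟩ := hc _ hk.1
    obtain ⟨n₂, h₂⟩ := hc _ hk.2
    refine ⟨n₂ - n₁, ?_⟩
    rw [abs_le] at *
    push_cast at *
    simp only [iterDiff, List.length_cons, pow_succ]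
    constructor <;> linarith

lemma card_le_of_forall_sub_le (Y : Finset ℤ) (D : ℝ) (hD : 0 ≤ D)
    (h : ∀ a ∈ Y, ∀ b ∈ Y, a < b → (b : ℝ) - a ≤ D) : (Y.card : ℝ) ≤ D + 1 := by
  rcases Y.eq_empty_or_nonempty with rfl | hne
  · simp; linarith
  have hsub : Y ⊆ Icc (Y.min' hne) (Y.max' hne) := fun y hy =>
    mem_Icc.2 ⟨min'_le _ _ hy, le_max' _ _ hy⟩
  have hc := card_le_card hsub
  rw [Int.card_Icc] at hc
  have hle : Y.min' hne ≤ Y.max' hne := min'_le_max' _ hne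
  have hdiff : ((Y.max' hne : ℤ) : ℝ) - (Y.min' hne : ℤ) ≤ D := by
    rcases hle.eq_or_lt with he | hlt
    · rw [← he]; simpa using hD
    · exact h _ (min'_mem _ _) _ (max'_mem _ _) hlt
  have h1 : (Y.card : ℤ) ≤ Y.max' hne + 1 - Y.min' hne := by omega
  have h2 : (Y.card : ℝ) ≤ Y.max' hne + 1 - Y.min' hne := by exact_mod_cast h1
  linarith

lemma card_le_of_near_multiples (Y : Finset ℕ) (F : ℕ → ℝ) (m η M B c : ℝ)
    (hm : 0 < m) (hη : 0 < η) (hM : 0 ≤ M) (hB : 0 ≤ B)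
    (hF : ∀ k ∈ Y, 0 ≤ F k ∧ F k ≤ M)
    (hinc : ∀ k ∈ Y, ∀ l ∈ Y, k < l → η * ((l : ℝ) - k) ≤ F l - F k)
    (hn : ∀ k ∈ Y, ∃ n : ℤ, |F k - c - m * n| ≤ B) :
    (Y.card : ℝ) ≤ (2 * B / η + 1) * ((M + 2 * B) / m + 1) := by
  choose! g hg using hn
  have hfib : ∀ a ∈ Y.image g, ((Y.filter (fun k => g k = a)).card) ≤ ⌊2 * B / η + 1⌋₊ := by
    intro a _
    apply Nat.le_floor
    have := card_le_of_forall_sub_le ((Y.filter (fun k => g k = a)).image (fun k : ℕ => (k : ℤ)))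
      (2 * B / η) (by positivity) (by
        intro x hx y hy hxy
        simp only [mem_image, mem_filter] at hx hy
        obtain ⟨k, ⟨hk, hka⟩, rfl⟩ := hx
        obtain ⟨l, ⟨hl, hla⟩, rfl⟩ := hy
        have h1 := hinc k hk l hl (by exact_mod_cast hxy)
        have h2 := abs_le.1 (hg k hk)
        have h3 := abs_le.1 (hg l hl)
        rw [hka] at h2
        rw [hla] at h3
        rw [le_div_iff₀ hη]
        push_cast
        linarith)
    rwa [card_image_of_injective _ Nat.cast_injective] at this
  have himg : ((Y.image g).card : ℝ) ≤ (M + 2 * B) / m + 1 := by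
    apply card_le_of_forall_sub_le _ _ (by positivity)
    intro x hx y hy _
    simp only [mem_image] at hx hy
    obtain ⟨k, hk, rfl⟩ := hx
    obtain ⟨l, hl, rfl⟩ := hy
    have h2 := abs_le.1 (hg k hk)
    have h3 := abs_le.1 (hg l hl)
    rw [le_div_iff₀ hm]
    linarith [(hF k hk).1, (hF l hl).2]
  have h1 := card_le_mul_card_image Y _ hfib
  have h2 : (Y.card : ℝ) ≤ (⌊2 * B / η + 1⌋₊ : ℝ) * ((Y.image g).card : ℝ) := by exact_mod_cast h1
  have h3 : (⌊2 * B / η + 1⌋₊ : ℝ) ≤ 2 * B / η + 1 := Nat.floor_le (by positivity)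
  calc (Y.card : ℝ) ≤ _ := h2
    _ ≤ _ := by gcongr

lemma card_le_div_add_sum_card_shift (Y : Finset ℕ) (K W : ℕ) (hY : Y ⊆ Icc 1 K) (hW : 1 ≤ W) :
    Y.card ≤ K / W + 1 + ∑ h ∈ Icc 1 W, (Y.filter (fun k => k + h ∈ Y)).card := by
  set I := Y.filter (fun k => ∀ h ∈ Icc 1 W, k + h ∉ Y) with hI
  have hcov : Y ⊆ I ∪ (Icc 1 W).biUnion (fun h => Y.filter (fun k => k + h ∈ Y)) := by
    intro k hk
    by_cases hk2 : ∀ h ∈ Icc 1 W, k + h ∉ Y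
    · exact mem_union_left _ (mem_filter.2 ⟨hk, hk2⟩)
    · push Not at hk2
      obtain ⟨h, hh, hh2⟩ := hk2
      exact mem_union_right _ (mem_biUnion.2 ⟨h, hh, mem_filter.2 ⟨hk, hh2⟩⟩)
  have hIc : I.card ≤ K / W + 1 := by
    rw [← card_range (K / W + 1)]
    apply card_le_card_of_injOn (fun k => k / W)
    · intro k hk
      have := mem_Icc.1 (hY (mem_filter.1 hk).1)
      simp only [coe_range, Set.mem_Iio]
      exact Nat.lt_succ_of_le (Nat.div_le_div_right this.2)
    · have key : ∀ a ∈ I, ∀ b ∈ I, a / W = b / W → ¬ a < b := by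
        intro a ha b hb hab hlt
        have h1 := Nat.div_add_mod a W
        have h2 := Nat.div_add_mod b W
        have h3 := Nat.mod_lt a hW
        have h4 := Nat.mod_lt b hW
        rw [hab] at h1
        have := (mem_filter.1 ha).2 (b - a) (mem_Icc.2 ⟨by omega, by omega⟩)
        rw [Nat.add_sub_cancel' hlt.le] at this
        exact this (mem_filter.1 hb).1
      intro a ha b hb hab
      exact le_antisymm (not_lt.1 (key b hb a ha hab.symm)) (not_lt.1 (key a ha b hb hab))
  calc Y.card ≤ _ := card_le_card hcov
    _ ≤ _ := card_union_le _ _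
    _ ≤ _ := add_le_add hIc card_biUnion_le

lemma card_shiftSet_le (r : ℝ) (q : ℕ) (hq : (q : ℝ) < r) (hq1 : r < q + 1) :
    ∃ C : ℝ, 1 ≤ C ∧ ∀ (K : ℕ) (m b : ℝ) (Z : Finset ℕ) (hs : List ℕ), 1 ≤ K → 1 ≤ m →
      Z ⊆ Icc 1 K → (∀ k ∈ Z, ∃ n : ℤ, |(k : ℝ) ^ r - b - m * n| ≤ 1) →
      hs.length = q → (∀ h ∈ hs, 1 ≤ h) →
      ((shiftSet Z hs).card : ℝ) ≤
        C * hs.prod * ((K : ℝ) ^ (1 - (r - q)) + K / m) := by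
  set α := r - q with hα
  have hα0 : 0 < α := by linarith
  have hα1 : α < 1 := by linarith
  set c₁ : ℝ := ∏ i ∈ range q, (r - i) with hc₁
  have hfac : ∀ i ∈ range q, 0 < r - (i : ℝ) := by
    intro i hi
    have : (i : ℝ) < q := by exact_mod_cast mem_range.1 hi
    linarith
  have hc₁0 : 0 < c₁ := prod_pos hfac
  set c₂ : ℝ := c₁ * α with hc₂
  have hc₂0 : 0 < c₂ := by positivity
  refine ⟨(2 * 2 ^ q / c₂ + 1) * (c₁ + 2 * 2 ^ q + 1), ?_, ?_⟩
  · have h1 : 0 ≤ 2 * 2 ^ q / c₂ := by positivity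
    have h2 : (1 : ℝ) ≤ 2 ^ q := one_le_pow₀ (by norm_num)
    nlinarith
  intro K m b Z hs hK hm hZ hn hlen hpos
  have hKr : (1 : ℝ) ≤ K := by exact_mod_cast hK
  have hK0 : (0 : ℝ) < K := by linarith
  have hprod : (1 : ℝ) ≤ (hs.prod : ℕ) := by exact_mod_cast List.one_le_prod_of_one_le hpos
  obtain ⟨c, hc⟩ := exists_near_multiple_of_mem_shiftSet Z (fun t => t ^ r) m b hn hs
  rw [hlen] at hc
  have hKα : (1 : ℝ) ≤ (K : ℝ) ^ α := Real.one_le_rpow hKr hα0.le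
  have hKα' : (1 : ℝ) ≤ (K : ℝ) ^ (1 - α) := Real.one_le_rpow hKr (by linarith)
  have hmul : (K : ℝ) ^ (1 - α) * (K : ℝ) ^ α = K := by
    rw [← Real.rpow_add hK0]; simp
  have hinv : (K : ℝ) ^ (α - 1) * (K : ℝ) ^ (1 - α) = 1 := by
    rw [← Real.rpow_add hK0]; simp
  have key := card_le_of_near_multiples (shiftSet Z hs)
    (fun k => iterDiff hs (fun t => t ^ r) k) m (c₂ * (K : ℝ) ^ (α - 1))
    (c₁ * hs.prod * (K : ℝ) ^ α) (2 ^ q) c (by linarith) (by positivity) (by positivity)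
    (by positivity) (by
      intro k hk
      obtain ⟨hk1, hk2⟩ := shiftSet_subset Z hs hk
      have hk1 := mem_Icc.1 (hZ hk1)
      have hk2 := mem_Icc.1 (hZ hk2)
      have hkpos : (0 : ℝ) < k := by exact_mod_cast hk1.1
      obtain ⟨ξ, h1, h2, h3⟩ := exists_iterDiff_rpow_eq hs r k hkpos
      have hξ : 0 < ξ := hkpos.trans_le h1
      have hξK : ξ ≤ K := h2.trans (by exact_mod_cast hk2.2)
      simp only [h3, hlen, ← hα, ← hc₁]
      refine ⟨by positivity, ?_⟩
      rw [mul_comm c₁]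
      gcongr)
    (by
      intro k hk l hl hkl
      obtain ⟨hk1, -⟩ := shiftSet_subset Z hs hk
      obtain ⟨-, hl2⟩ := shiftSet_subset Z hs hl
      have hk1 := mem_Icc.1 (hZ hk1)
      have hl2 := mem_Icc.1 (hZ hl2)
      have hkpos : (0 : ℝ) < k := by exact_mod_cast hk1.1
      obtain ⟨ξ, h1, h2, h3⟩ := exists_iterDiff_rpow_eq ((l - k) :: hs) r k hkpos
      have hξ : 0 < ξ := hkpos.trans_le h1
      have hξK : ξ ≤ K := h2.trans (by
        rw [List.sum_cons]
        exact_mod_cast (show k + (l - k + hs.sum) ≤ K by omega))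
      have hlk : ((l - k : ℕ) : ℝ) = l - k := Nat.cast_sub hkl.le
      have e : (k : ℝ) + ((l - k : ℕ) : ℝ) = l := by rw [hlk]; ring
      simp only [iterDiff, e] at h3
      rw [h3, List.length_cons, prod_range_succ, hlen, ← hc₁, ← hα, List.prod_cons, ← hc₂]
      have e2 : r - ((q + 1 : ℕ) : ℝ) = α - 1 := by push_cast; ring
      rw [e2]
      have e3 : (K : ℝ) ^ (α - 1) ≤ ξ ^ (α - 1) :=
        Real.rpow_le_rpow_of_nonpos hξ hξK (by linarith)
      have e4 : (0 : ℝ) ≤ (l : ℝ) - k := by rw [← hlk]; positivity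
      push_cast [hlk]
      calc c₂ * (K : ℝ) ^ (α - 1) * ((l : ℝ) - k)
          = ((l : ℝ) - k) * 1 * c₂ * (K : ℝ) ^ (α - 1) := by ring
        _ ≤ _ := by
          have : (0:ℝ) ≤ ((l : ℝ) - k) * (hs.prod : ℕ) * c₂ := by positivity
          have hp := hprod
          push_cast at hp
          gcongr)
    hc
  refine key.trans ?_
  have f1 : 2 * 2 ^ q / (c₂ * (K : ℝ) ^ (α - 1)) + 1
      ≤ (2 * 2 ^ q / c₂ + 1) * (K : ℝ) ^ (1 - α) := by
    have : 2 * 2 ^ q / (c₂ * (K : ℝ) ^ (α - 1)) = 2 * 2 ^ q / c₂ * (K : ℝ) ^ (1 - α) := by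
      rw [div_mul_eq_mul_div, div_eq_div_iff (by positivity) (by positivity)]
      linear_combination (-(2 * 2 ^ q * c₂)) * hinv
    rw [this, add_mul]
    linarith
  have f2 : (c₁ * hs.prod * (K : ℝ) ^ α + 2 * 2 ^ q) / m + 1
      ≤ (c₁ + 2 * 2 ^ q + 1) * hs.prod * ((K : ℝ) ^ α / m + 1) := by
    have g0 : 2 * 2 ^ q / m ≤ (2 * 2 ^ q : ℝ) := div_le_self (by positivity) hm
    have g1 : (0 : ℝ) ≤ (K : ℝ) ^ α / m := by positivity
    have g2 : (2 * 2 ^ q + 1 : ℝ) ≤ (2 * 2 ^ q + 1) * hs.prod :=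
      le_mul_of_one_le_right (by positivity) hprod
    have g3 : 0 ≤ (2 * 2 ^ q + 1) * (hs.prod : ℝ) * ((K : ℝ) ^ α / m) := by positivity
    have g4 : 0 ≤ c₁ * (hs.prod : ℝ) := by positivity
    have g5 : (c₁ * hs.prod * (K : ℝ) ^ α + 2 * 2 ^ q) / m
      = c₁ * hs.prod * ((K : ℝ) ^ α / m) + 2 * 2 ^ q / m := by ring
    rw [g5]
    nlinarith
  calc _ ≤ ((2 * 2 ^ q / c₂ + 1) * (K : ℝ) ^ (1 - α)) *
        ((c₁ + 2 * 2 ^ q + 1) * hs.prod * ((K : ℝ) ^ α / m + 1)) := by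
        apply mul_le_mul f1 f2 (by positivity) (by positivity)
    _ = (2 * 2 ^ q / c₂ + 1) * (c₁ + 2 * 2 ^ q + 1) * hs.prod
        * ((K : ℝ) ^ (1 - α) + (K : ℝ) ^ (1 - α) * (K : ℝ) ^ α / m) := by ring
    _ = _ := by rw [hmul]

lemma card_shiftSet_le_of_length_add (r : ℝ) (q : ℕ) (hq : (q : ℝ) < r) (hq1 : r < q + 1)
    (i : ℕ) : ∃ C : ℝ, 1 ≤ C ∧ ∃ A : ℕ, ∀ (K : ℕ) (m b : ℝ) (Z : Finset ℕ) (hs : List ℕ) (W : ℕ),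
      1 ≤ K → 1 ≤ m → Z ⊆ Icc 1 K → (∀ k ∈ Z, ∃ n : ℤ, |(k : ℝ) ^ r - b - m * n| ≤ 1) →
      hs.length + i = q → (∀ h ∈ hs, 1 ≤ h) → 1 ≤ W →
      ((shiftSet Z hs).card : ℝ) ≤
        C * (K / W + (W * hs.prod : ℝ) ^ A * ((K : ℝ) ^ (1 - (r - q)) + K / m)) := by
  induction i with
  | zero =>
    obtain ⟨C, hC1, hC⟩ := card_shiftSet_le r q hq hq1
    refine ⟨C, hC1, 1, ?_⟩
    intro K m b Z hs W hK hm hZ hn hlen hpos hW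
    have h1 := hC K m b Z hs hK hm hZ hn (by simpa using hlen) hpos
    have hWr : (1 : ℝ) ≤ W := by exact_mod_cast hW
    refine h1.trans ?_
    rw [mul_assoc, pow_one]
    have h2 : (hs.prod : ℝ) ≤ W * hs.prod := le_mul_of_one_le_left (by positivity) hWr
    have h3 : (0 : ℝ) ≤ K / W := by positivity
    have h4 : (0 : ℝ) ≤ (K : ℝ) ^ (1 - (r - q)) + K / m := by positivity
    have h5 := mul_le_mul_of_nonneg_right h2 h4
    have h0 : (0 : ℝ) ≤ C := by linarith
    gcongr
    linarith
  | succ i ih =>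
    obtain ⟨C, hC1, A, hC⟩ := ih
    refine ⟨C + 2, by linarith, 3 * A + 1, ?_⟩
    intro K m b Z hs W hK hm hZ hn hlen hpos hW
    have hWr : (1 : ℝ) ≤ W := by exact_mod_cast hW
    have hKr : (1 : ℝ) ≤ K := by exact_mod_cast hK
    have hprod : (1 : ℝ) ≤ (hs.prod : ℕ) := by exact_mod_cast List.one_le_prod_of_one_le hpos
    have hKα' : (1 : ℝ) ≤ (K : ℝ) ^ (1 - (r - q)) := Real.one_le_rpow hKr (by linarith)
    set R := (K : ℝ) ^ (1 - (r - q)) + K / m with hR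
    have hR1 : 1 ≤ R := by
      have : (0 : ℝ) ≤ K / m := by positivity
      linarith
    have h1 := card_le_div_add_sum_card_shift (shiftSet Z hs) K W
      (fun k hk => hZ (shiftSet_subset Z hs hk).1) hW
    have h2 : ∀ h ∈ Icc 1 W, (((shiftSet Z hs).filter (fun k => k + h ∈ shiftSet Z hs)).card : ℝ)
        ≤ C * (K / (W ^ 2 : ℕ) + (W ^ 3 * hs.prod : ℝ) ^ A * R) := by
      intro h hh
      have hh := mem_Icc.1 hh
      have h3 := hC K m b Z (h :: hs) (W ^ 2) hK hm hZ hn (by simp; omega)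
        (by intro x hx
            rcases List.mem_cons.1 hx with rfl | hx
            · exact hh.1
            · exact hpos x hx) (Nat.one_le_pow _ _ hW)
      refine h3.trans ?_
      have hhW : (h : ℝ) ≤ W := by exact_mod_cast hh.2
      have e : (((W ^ 2 : ℕ) : ℝ) * ((h :: hs).prod : ℕ)) ≤ (W ^ 3 * hs.prod : ℝ) := by
        rw [List.prod_cons, Nat.cast_mul, Nat.cast_pow]
        calc (W : ℝ) ^ 2 * (h * (hs.prod : ℕ)) ≤ (W : ℝ) ^ 2 * (W * (hs.prod : ℕ)) := by gcongr
          _ = (W : ℝ) ^ 3 * hs.prod := by ring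
      gcongr
    have h4 : ((shiftSet Z hs).card : ℝ) ≤ (K / W : ℕ) + 1
        + ∑ h ∈ Icc 1 W, (((shiftSet Z hs).filter (fun k => k + h ∈ shiftSet Z hs)).card : ℝ) := by
      exact_mod_cast h1
    have h5 := sum_le_sum h2
    rw [sum_const, Nat.card_Icc, nsmul_eq_mul] at h5
    have h6 : ((K / W : ℕ) : ℝ) ≤ K / W := Nat.cast_div_le
    have h7 : ((W + 1 - 1 : ℕ) : ℝ) * (C * (K / (W ^ 2 : ℕ) + (W ^ 3 * hs.prod : ℝ) ^ A * R))
        = C * (K / W) + C * ((W * (W ^ 3 * hs.prod : ℝ) ^ A) * R) := by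
      rw [Nat.add_sub_cancel]
      push_cast
      field_simp
    have h8 : W * (W ^ 3 * hs.prod : ℝ) ^ A ≤ (W * hs.prod : ℝ) ^ (3 * A + 1) := by
      have g1 : (W ^ 3 * hs.prod : ℝ) ≤ (W * hs.prod : ℝ) ^ 3 := by
        rw [mul_pow]
        gcongr
        exact le_self_pow₀ hprod (by norm_num)
      rw [pow_succ _ (3 * A), pow_mul, mul_comm (W : ℝ)]
      gcongr
      exact le_mul_of_one_le_right (by positivity) hprod
    have h9 : 1 ≤ (W * hs.prod : ℝ) ^ (3 * A + 1) := one_le_pow₀ (one_le_mul_of_one_le_of_one_le hWr hprod)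
    have h10 : (W * (W ^ 3 * hs.prod : ℝ) ^ A) * R ≤ (W * hs.prod : ℝ) ^ (3 * A + 1) * R := by
      gcongr
    have h11 : 1 ≤ (W * hs.prod : ℝ) ^ (3 * A + 1) * R := one_le_mul_of_one_le_of_one_le h9 hR1
    have h12 : (0 : ℝ) ≤ K / W := by positivity
    have h13 := mul_le_mul_of_nonneg_left h10 (show 0 ≤ C by linarith)
    rw [h7] at h5
    linarith

/-- The values `⌊k ^ r⌋`, for `r > 1` not an integer, spread over the residue classes modulo `m`
with a power saving. -/
lemma card_floor_rpow_modEq_le (r : ℝ) (hr : 1 < r) (hri : ∀ m : ℤ, r ≠ m) :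
    ∃ C : ℝ, 0 < C ∧ ∃ δ : ℝ, 0 < δ ∧ ∀ (K m b : ℕ), 1 ≤ K → 1 ≤ m →
      (((Icc 1 K).filter (fun k : ℕ => ⌊(k : ℝ) ^ r⌋₊ ≡ b [MOD m])).card : ℝ) ≤
        C * K * ((m : ℝ) ^ (-δ) + (K : ℝ) ^ (-δ)) := by
  set q := ⌊r⌋₊ with hqdef
  have hq : (q : ℝ) < r := lt_of_le_of_ne (Nat.floor_le (by linarith))
    (fun h => hri q (by rw [← h]; simp))
  have hq1 : r < q + 1 := Nat.lt_floor_add_one r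
  obtain ⟨C, hC1, A, hC⟩ := card_shiftSet_le_of_length_add r q hq hq1 q
  set α := r - q with hα
  have hα0 : 0 < α := by linarith
  have hα1 : α < 1 := by linarith
  set δ : ℝ := 1 / (A + 1) with hδ
  have hδ0 : 0 < δ := by positivity
  have hAδ : (A : ℝ) * δ - 1 = -δ := by rw [hδ]; field_simp; ring
  refine ⟨C * 4, by linarith, α * δ, by positivity, ?_⟩
  intro K m b hK hm
  have hKr : (1 : ℝ) ≤ K := by exact_mod_cast hK
  have hK0 : (0 : ℝ) < K := by linarith
  have hmr : (1 : ℝ) ≤ m := by exact_mod_cast hm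
  set t : ℝ := min (m : ℝ) ((K : ℝ) ^ α) with ht
  have ht1 : 1 ≤ t := le_min hmr (Real.one_le_rpow hKr hα0.le)
  have ht0 : 0 < t := by linarith
  have htδ : 1 ≤ t ^ δ := Real.one_le_rpow ht1 hδ0.le
  set W := ⌊t ^ δ⌋₊ with hW
  have hW1 : 1 ≤ W := Nat.le_floor (by simpa using htδ)
  have hWr : (1 : ℝ) ≤ W := by exact_mod_cast hW1
  have hWle : (W : ℝ) ≤ t ^ δ := Nat.floor_le (by positivity)
  have hWge : t ^ δ ≤ 2 * W := by
    have := Nat.lt_floor_add_one (t ^ δ)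
    rw [← hW] at this
    linarith
  have h1 := hC K m b ((Icc 1 K).filter (fun k : ℕ => ⌊(k : ℝ) ^ r⌋₊ ≡ b [MOD m])) [] W hK hmr
    (filter_subset _ _) (by
      intro k hk
      have hk := (mem_filter.1 hk).2
      obtain ⟨n, hn⟩ := (Nat.modEq_iff_dvd.1 hk.symm)
      refine ⟨n, ?_⟩
      have hn' : ((⌊(k : ℝ) ^ r⌋₊ : ℕ) : ℝ) - b = m * n := by exact_mod_cast hn
      have g1 := Nat.floor_le (show 0 ≤ (k : ℝ) ^ r by positivity)
      have g2 := Nat.lt_floor_add_one ((k : ℝ) ^ r)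
      rw [abs_le]
      constructor <;> linarith) (by simp) (by simp) hW1
  simp only [shiftSet, List.prod_nil, Nat.cast_one, mul_one] at h1
  refine h1.trans ?_
  have e1 : (K : ℝ) ^ (1 - α) = K * (K : ℝ) ^ (-α) := by
    rw [sub_eq_add_neg, Real.rpow_add hK0, Real.rpow_one]
  have e2 : (K : ℝ) ^ (-α) ≤ 1 / t := by
    rw [Real.rpow_neg hK0.le, ← one_div]
    gcongr
    exact min_le_right _ _
  have e3 : (1 : ℝ) / m ≤ 1 / t := by
    gcongr
    exact min_le_left _ _
  have e4 : (W : ℝ) ^ A ≤ t ^ (A * δ) := by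
    calc (W : ℝ) ^ A ≤ (t ^ δ) ^ A := by gcongr
      _ = _ := by rw [← Real.rpow_natCast, ← Real.rpow_mul ht0.le, mul_comm]
  have e5 : t ^ (A * δ) * (1 / t) = t ^ (-δ) := by
    rw [← hAδ, Real.rpow_sub_one ht0.ne']; ring
  have e6 : (1 : ℝ) / W ≤ 2 * t ^ (-δ) := by
    rw [Real.rpow_neg ht0.le, div_le_iff₀ (by linarith)]
    have : 2 * (t ^ δ)⁻¹ * W = (2 * W) / t ^ δ := by ring
    rw [this, one_le_div (by positivity)]
    exact hWge
  have e7 : t ^ (-δ) ≤ (m : ℝ) ^ (-(α * δ)) + (K : ℝ) ^ (-(α * δ)) := by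
    have p1 : (0 : ℝ) ≤ (m : ℝ) ^ (-(α * δ)) := by positivity
    have p2 : (0 : ℝ) ≤ (K : ℝ) ^ (-(α * δ)) := by positivity
    rcases min_choice (m : ℝ) ((K : ℝ) ^ α) with h | h
    · rw [ht, h]
      have : (m : ℝ) ^ (-δ) ≤ (m : ℝ) ^ (-(α * δ)) :=
        Real.rpow_le_rpow_of_exponent_le hmr (by nlinarith)
      linarith
    · rw [ht, h, ← Real.rpow_mul hK0.le, mul_neg]
      linarith
  have e8 : (K : ℝ) / W + (W : ℝ) ^ A * ((K : ℝ) ^ (1 - α) + K / m)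
      ≤ K * (4 * t ^ (-δ)) := by
    have : (K : ℝ) / W + (W : ℝ) ^ A * ((K : ℝ) ^ (1 - α) + K / m)
        = K * (1 / W + (W : ℝ) ^ A * ((K : ℝ) ^ (-α) + 1 / m)) := by
      rw [e1]; ring
    rw [this]
    gcongr
    calc (1 : ℝ) / W + (W : ℝ) ^ A * ((K : ℝ) ^ (-α) + 1 / m)
        ≤ 2 * t ^ (-δ) + t ^ (A * δ) * (1 / t + 1 / t) := by gcongr
      _ = 2 * t ^ (-δ) + 2 * (t ^ (A * δ) * (1 / t)) := by ring
      _ = _ := by rw [e5]; ring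
  calc _ ≤ C * (K * (4 * t ^ (-δ))) := by gcongr
    _ = C * 4 * K * t ^ (-δ) := by ring
    _ ≤ _ := by gcongr

lemma sum_neg_one_pow_card_between (𝒟 : Finset (Finset ℕ))
    (hdown : ∀ T ∈ 𝒟, ∀ U, U ⊆ T → U ∈ 𝒟) (K M : Finset ℕ) (hM : M ∈ 𝒟) :
    ∑ T ∈ 𝒟, (if K ⊆ T ∧ T ⊆ M then (-1 : ℝ) ^ T.card else 0)
      = if K = M then (-1 : ℝ) ^ K.card else 0 := by
  rw [← sum_filter]
  by_cases hKM : K ⊆ M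
  · have e : 𝒟.filter (fun T => K ⊆ T ∧ T ⊆ M) = Finset.Icc K M := by
      ext T
      simp only [mem_filter, Finset.mem_Icc]
      exact ⟨fun h => h.2, fun h => ⟨hdown M hM T h.2, h⟩⟩
    rw [e, Finset.Icc_eq_image_powerset hKM, sum_image]
    · have e2 : ∀ x ∈ (M \ K).powerset, (-1 : ℝ) ^ (K ∪ x).card
          = (-1) ^ K.card * (((-1 : ℤ) ^ x.card : ℤ) : ℝ) := by
        intro x hx
        rw [card_union_of_disjoint
          (disjoint_of_subset_right (mem_powerset.1 hx) disjoint_sdiff), pow_add]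
        push_cast
        rfl
      rw [sum_congr rfl e2, ← mul_sum, ← Int.cast_sum, sum_powerset_neg_one_pow_card]
      by_cases hK : K = M
      · simp [hK]
      · have : M \ K ≠ ∅ := fun h => hK (hKM.antisymm (sdiff_eq_empty_iff_subset.1 h))
        simp [hK, this]
    · intro x hx y hy hxy
      have hx' := disjoint_of_subset_right (mem_powerset.1 hx) (disjoint_sdiff (s := K))
      have hy' := disjoint_of_subset_right (mem_powerset.1 hy) (disjoint_sdiff (s := K))
      have := congrArg (· \ K) hxy
      simpa [union_sdiff_cancel_left hx', union_sdiff_cancel_left hy'] using this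
  · have hne : K ≠ M := fun h => hKM (h ▸ Subset.rfl)
    rw [if_neg hne]
    apply sum_eq_zero
    intro T hT
    have := (mem_filter.1 hT).2
    exact absurd (this.1.trans this.2) hKM

/-- Selberg's weights, for a downward closed family of sets of primes. -/
lemma exists_selberg_weights (𝒟 : Finset (Finset ℕ)) (hne : ∅ ∈ 𝒟)
    (hdown : ∀ T ∈ 𝒟, ∀ U, U ⊆ T → U ∈ 𝒟) (f : ℕ → ℝ) (hf : ∀ T ∈ 𝒟, ∀ p ∈ T, 1 < f p) :
    ∃ w : Finset ℕ → ℝ, w ∅ = 1 ∧ (∀ T ∈ 𝒟, |w T| ≤ ∏ p ∈ T, f p) ∧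
      ∑ T ∈ 𝒟, ∑ U ∈ 𝒟, w T * w U / ∏ p ∈ T ∪ U, f p
        = 1 / ∑ T ∈ 𝒟, ∏ p ∈ T, 1 / (f p - 1) := by
  set g : Finset ℕ → ℝ := fun T => ∏ p ∈ T, 1 / (f p - 1) with hg
  set S := ∑ T ∈ 𝒟, g T with hS
  have hg0 : ∀ T ∈ 𝒟, 0 < g T := fun T hT =>
    prod_pos fun p hp => one_div_pos.2 (sub_pos.2 (hf T hT p hp))
  have hS0 : 0 < S := sum_pos hg0 ⟨∅, hne⟩
  have hF0 : ∀ T ∈ 𝒟, 0 < ∏ p ∈ T, f p := fun T hT =>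
    prod_pos fun p hp => by linarith [hf T hT p hp]
  set w : Finset ℕ → ℝ := fun T => (∏ p ∈ T, f p) * (-1) ^ T.card / S
    * ∑ M ∈ 𝒟, if T ⊆ M then g M else 0 with hw
  have hy : ∀ K ∈ 𝒟, ∑ T ∈ 𝒟, (if K ⊆ T then w T / ∏ p ∈ T, f p else 0)
      = (-1) ^ K.card * g K / S := by
    intro K hK
    calc ∑ T ∈ 𝒟, (if K ⊆ T then w T / ∏ p ∈ T, f p else 0)
        = ∑ T ∈ 𝒟, ∑ M ∈ 𝒟, g M / S * (if K ⊆ T ∧ T ⊆ M then (-1 : ℝ) ^ T.card else 0) := by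
          refine sum_congr rfl fun T hT => ?_
          have := (hF0 T hT).ne'
          by_cases h : K ⊆ T
          · simp only [h, if_true, hw, true_and]
            rw [mul_div_right_comm, mul_sum]
            refine sum_congr rfl fun M _ => ?_
            split_ifs
            · field_simp
            · simp
          · simp [h]
      _ = ∑ M ∈ 𝒟, g M / S * (if K = M then (-1 : ℝ) ^ K.card else 0) := by
          rw [sum_comm]
          refine sum_congr rfl fun M hM => ?_
          rw [← mul_sum, sum_neg_one_pow_card_between 𝒟 hdown K M hM]
      _ = _ := by
          simp only [mul_ite, mul_zero, sum_ite_eq, hK, if_true]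
          ring
  refine ⟨w, ?_, ?_, ?_⟩
  · simp only [hw, prod_empty, card_empty, pow_zero, empty_subset, if_true, ← hS]
    field_simp
  · intro T hT
    have h1 : ∑ M ∈ 𝒟, (if T ⊆ M then g M else 0) ≤ S :=
      sum_le_sum fun M hM => by split_ifs <;> [exact le_rfl; exact (hg0 M hM).le]
    have h2 : 0 ≤ ∑ M ∈ 𝒟, (if T ⊆ M then g M else 0) :=
      sum_nonneg fun M hM => by split_ifs <;> [exact (hg0 M hM).le; exact le_rfl]
    simp only [hw, abs_mul, abs_div, abs_pow, abs_neg, abs_one, one_pow, mul_one,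
      abs_of_pos hS0, abs_of_pos (hF0 T hT), abs_of_nonneg h2]
    rw [div_mul_eq_mul_div, div_le_iff₀ hS0]
    exact mul_le_mul_of_nonneg_left h1 (hF0 T hT).le
  · have hexp : ∀ T ∈ 𝒟, ∀ U ∈ 𝒟, w T * w U / ∏ p ∈ T ∪ U, f p
        = ∑ K ∈ 𝒟, (∏ p ∈ K, (f p - 1)) * ((if K ⊆ T then w T / ∏ p ∈ T, f p else 0)
          * (if K ⊆ U then w U / ∏ p ∈ U, f p else 0)) := by
      intro T hT U hU
      have h1 := prod_union_inter (s₁ := T) (s₂ := U) (f := f)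
      have h2 : ∏ p ∈ T ∩ U, f p = ∑ K ∈ (T ∩ U).powerset, ∏ p ∈ K, (f p - 1) := by
        rw [← prod_add_one]
        exact prod_congr rfl fun p _ => by ring
      have h3 : 𝒟.filter (fun K => K ⊆ T ∩ U) = (T ∩ U).powerset := by
        ext K
        simp only [mem_filter, mem_powerset]
        exact ⟨fun h => h.2, fun h => ⟨hdown T hT K (h.trans inter_subset_left), h⟩⟩
      have hT0 := (hF0 T hT).ne'
      have hU0 := (hF0 U hU).ne'
      have hTU0 : ∏ p ∈ T ∪ U, f p ≠ 0 := by
        intro h0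
        rw [h0, zero_mul] at h1
        exact mul_ne_zero hT0 hU0 h1.symm
      have h4 : w T * w U / ∏ p ∈ T ∪ U, f p
          = (∏ p ∈ T ∩ U, f p) * ((w T / ∏ p ∈ T, f p) * (w U / ∏ p ∈ U, f p)) := by
        rw [div_mul_div_comm, ← h1, ← mul_div_assoc, div_eq_div_iff hTU0 (h1 ▸ mul_ne_zero hT0 hU0)]
        ring
      rw [h4, h2, ← h3, sum_filter, sum_mul]
      refine sum_congr rfl fun K _ => ?_
      simp only [subset_inter_iff]
      by_cases a : K ⊆ T <;> by_cases b : K ⊆ U <;> simp [a, b]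
    calc _ = ∑ T ∈ 𝒟, ∑ U ∈ 𝒟, ∑ K ∈ 𝒟, (∏ p ∈ K, (f p - 1)) *
          ((if K ⊆ T then w T / ∏ p ∈ T, f p else 0)
          * (if K ⊆ U then w U / ∏ p ∈ U, f p else 0)) :=
          sum_congr rfl fun T hT => sum_congr rfl fun U hU => hexp T hT U hU
      _ = ∑ K ∈ 𝒟, (∏ p ∈ K, (f p - 1)) *
          ((∑ T ∈ 𝒟, (if K ⊆ T then w T / ∏ p ∈ T, f p else 0))
          * (∑ U ∈ 𝒟, if K ⊆ U then w U / ∏ p ∈ U, f p else 0)) := by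
          rw [sum_congr rfl fun T _ => sum_comm, sum_comm]
          refine sum_congr rfl fun K _ => ?_
          rw [sum_mul_sum, mul_sum]
          refine sum_congr rfl fun T _ => ?_
          rw [mul_sum]
      _ = ∑ K ∈ 𝒟, g K / S ^ 2 := by
          refine sum_congr rfl fun K hK => ?_
          rw [hy K hK]
          have h1 : (∏ p ∈ K, (f p - 1)) * g K = 1 := by
            rw [hg, ← prod_mul_distrib]
            exact prod_eq_one fun p hp => mul_one_div_cancel (sub_pos.2 (hf K hK p hp)).ne'
          have h2 : ((-1 : ℝ) ^ K.card) * (-1) ^ K.card = 1 := by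
            rw [← mul_pow]; norm_num
          calc _ = ((∏ p ∈ K, (f p - 1)) * g K) * (((-1 : ℝ) ^ K.card) * (-1) ^ K.card)
                * (g K / S ^ 2) := by ring
            _ = _ := by rw [h1, h2]; ring
      _ = 1 / S := by
          rw [← sum_div, ← hS]
          field_simp

lemma card_filter_range_mul_of_coprime (a b : ℕ) (ha : 0 < a) (hb : 0 < b) (hab : a.Coprime b)
    (P Q : ℕ → Prop) [DecidablePred P] [DecidablePred Q]
    (hP : ∀ n, P (n % a) ↔ P n) (hQ : ∀ n, Q (n % b) ↔ Q n) :
    ((range (a * b)).filter (fun n => P n ∧ Q n)).card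
      = ((range a).filter P).card * ((range b).filter Q).card := by
  rw [← card_product]
  refine card_bij' (fun n _ => (n % a, n % b)) (fun x _ => (Nat.chineseRemainder hab x.1 x.2 : ℕ))
    ?_ ?_ ?_ ?_
  · intro n hn
    simp only [mem_filter, mem_range, mem_product] at hn ⊢
    exact ⟨⟨Nat.mod_lt _ ha, (hP n).2 hn.2.1⟩, Nat.mod_lt _ hb, (hQ n).2 hn.2.2⟩
  · rintro ⟨x, y⟩ hxy
    simp only [mem_filter, mem_range, mem_product] at hxy ⊢
    refine ⟨Nat.chineseRemainder_lt_mul hab x y ha.ne' hb.ne', ?_, ?_⟩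
    · rw [← hP, (Nat.chineseRemainder hab x y).2.1, hP]; exact hxy.1.2
    · rw [← hQ, (Nat.chineseRemainder hab x y).2.2, hQ]; exact hxy.2.2
  · intro n hn
    simp only [mem_filter, mem_range] at hn
    have h1 := Nat.chineseRemainder_modEq_unique hab (a := n % a) (b := n % b) (z := n)
      (Nat.mod_modEq _ _).symm (Nat.mod_modEq _ _).symm
    exact (Nat.ModEq.eq_of_lt_of_lt h1 hn.1
      (Nat.chineseRemainder_lt_mul hab _ _ ha.ne' hb.ne')).symm
  · rintro ⟨x, y⟩ hxy
    simp only [mem_filter, mem_range, mem_product] at hxy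
    have h := (Nat.chineseRemainder hab x y).2
    ext
    · exact Nat.ModEq.eq_of_lt_of_lt ((Nat.mod_modEq _ _).trans h.1) (Nat.mod_lt _ ha) hxy.1.1
    · exact Nat.ModEq.eq_of_lt_of_lt ((Nat.mod_modEq _ _).trans h.2) (Nat.mod_lt _ hb) hxy.2.1

/-- The number of roots of `n (n + h)` modulo the prime `p`. -/
def rootCount (h p : ℕ) : ℕ := if p ∣ h then 1 else 2

lemma card_roots_eq_rootCount (h p : ℕ) (hp : p.Prime) :
    ((range p).filter (fun n => p ∣ n * (n + h))).card = rootCount h p := by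
  unfold rootCount
  have hp0 := hp.pos
  split_ifs with hd
  · rw [card_eq_one]
    refine ⟨0, ?_⟩
    ext n
    simp only [mem_filter, mem_range, mem_singleton, hp.dvd_mul, (Nat.dvd_add_left hd), or_self]
    constructor
    · exact fun hn => Nat.eq_zero_of_dvd_of_lt hn.2 hn.1
    · rintro rfl; exact ⟨hp0, dvd_zero _⟩
  · have hm : 0 < h % p := Nat.pos_of_ne_zero fun h0 => hd (Nat.dvd_of_mod_eq_zero h0)
    have hm2 := Nat.mod_lt h hp0
    have : (range p).filter (fun n => p ∣ n * (n + h)) = {0, p - h % p} := by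
      ext n
      simp only [mem_filter, mem_range, mem_insert, mem_singleton, hp.dvd_mul]
      constructor
      · rintro ⟨hn, h1 | h1⟩
        · exact Or.inl (Nat.eq_zero_of_dvd_of_lt h1 hn)
        · right
          have h2 : p ∣ n + h % p := by
            rw [Nat.dvd_iff_mod_eq_zero] at h1 ⊢
            rw [← h1]; simp
          obtain ⟨c, hc⟩ := h2
          have : c = 1 := by
            have c1 : 0 < c := Nat.pos_of_ne_zero (by rintro rfl; omega)
            have c2 : c < 2 := by
              by_contra hc2
              have : p * 2 ≤ p * c := Nat.mul_le_mul_left _ (by omega)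
              omega
            omega
          subst this
          omega
      · rintro (rfl | rfl)
        · exact ⟨hp0, Or.inl (dvd_zero _)⟩
        · refine ⟨by omega, Or.inr ?_⟩
          have := Nat.div_add_mod h p
          exact ⟨h / p + 1, by rw [Nat.mul_add]; omega⟩
    rw [this, card_pair (by omega)]

lemma card_common_roots (h : ℕ) (U : Finset ℕ) (hU : ∀ p ∈ U, p.Prime) :
    ((range (∏ p ∈ U, p)).filter (fun n => ∀ p ∈ U, p ∣ n * (n + h))).card
      = ∏ p ∈ U, rootCount h p := by
  induction U using Finset.induction_on with
  | empty => simp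
  | insert p U hpU ih =>
    have hp := hU p (mem_insert_self _ _)
    have hU' : ∀ q ∈ U, q.Prime := fun q hq => hU q (mem_insert_of_mem hq)
    rw [prod_insert hpU, prod_insert hpU, ← ih hU', ← card_roots_eq_rootCount h p hp]
    have per : ∀ q d n, q ∣ d → (q ∣ n % d * (n % d + h) ↔ q ∣ n * (n + h)) := by
      intro q d n hqd
      apply Nat.ModEq.dvd_iff _ dvd_rfl
      have : n % d ≡ n [MOD q] := (Nat.mod_modEq n d).of_dvd hqd
      exact this.mul (this.add_right h)
    rw [← card_filter_range_mul_of_coprime p (∏ q ∈ U, q) hp.pos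
      (prod_pos fun q hq => (hU' q hq).pos)
      (Nat.Coprime.prod_right fun q hq => (Nat.coprime_primes hp (hU' q hq)).2
        (by rintro rfl; exact hpU hq)) _ _ (fun n => per p p n dvd_rfl)
      (fun n => forall₂_congr fun q hq => per q _ n (dvd_prod_of_mem _ hq))]
    simp

lemma abs_card_common_roots_sub_le (h N : ℕ) (U : Finset ℕ) (hU : ∀ p ∈ U, p.Prime) :
    |(((range N).filter (fun n => ∀ p ∈ U, p ∣ n * (n + h))).card : ℝ)
      - N / ∏ p ∈ U, ((p : ℝ) / rootCount h p)| ≤ ∏ p ∈ U, (rootCount h p : ℝ) := by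
  set d := ∏ p ∈ U, p with hd
  set ρ := ∏ p ∈ U, rootCount h p with hρ
  have hd0 : 0 < d := prod_pos fun q hq => (hU q hq).pos
  set P : ℕ → Prop := fun n => ∀ p ∈ U, p ∣ n * (n + h) with hP
  have hper : Function.Periodic P d := by
    intro n
    apply propext
    refine forall₂_congr fun q hq => ?_
    apply Nat.ModEq.dvd_iff _ dvd_rfl
    have : n + d ≡ n [MOD q] := by
      have hqd : q ∣ d := dvd_prod_of_mem _ hq
      exact (Nat.modEq_iff_dvd' (by omega)).2 (by simpa using hqd) |>.symm
    exact this.mul (this.add_right h)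
  have hcd : Nat.count P d = ρ := by
    rw [Nat.count_eq_card_filter_range]; exact card_common_roots h U hU
  have hmul : ∀ c, Nat.count P (d * c) = c * ρ := by
    intro c
    induction c with
    | zero => simp
    | succ c ih =>
      rw [Nat.mul_succ, Nat.count_add, ih]
      have : (fun k => P (d * c + k)) = P := by
        funext k
        rw [add_comm, mul_comm]
        exact hper.nat_mul c k
      simp only [this, hcd]
      ring
  rw [← Nat.count_eq_card_filter_range]
  set c := N / d with hc
  have h1 : c * ρ ≤ Nat.count P N := by
    rw [← hmul]; exact Nat.count_monotone P (Nat.mul_div_le N d)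
  have h2 : Nat.count P N ≤ (c + 1) * ρ := by
    rw [← hmul]; exact Nat.count_monotone P (Nat.lt_mul_div_succ N hd0).le
  have h1' : (c : ℝ) * ρ ≤ Nat.count P N := by exact_mod_cast h1
  have h2' : (Nat.count P N : ℝ) ≤ (c + 1) * ρ := by exact_mod_cast h2
  have hdr : (0 : ℝ) < d := by exact_mod_cast hd0
  have h3 : (c : ℝ) ≤ N / d := Nat.cast_div_le
  have h4 : (N : ℝ) / d ≤ c + 1 := by
    rw [div_le_iff₀ hdr]
    have := (Nat.lt_mul_div_succ N hd0).le
    rw [mul_comm] at this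
    exact_mod_cast this
  have e : (N : ℝ) / ∏ p ∈ U, ((p : ℝ) / rootCount h p) = N / d * ρ := by
    rw [prod_div_distrib, hd, hρ]
    push_cast
    rw [div_div_eq_mul_div]
    ring
  have e2 : ∏ p ∈ U, (rootCount h p : ℝ) = ρ := by rw [hρ]; push_cast; rfl
  rw [e, e2, abs_le]
  have hρ0 : (0 : ℝ) ≤ ρ := by positivity
  constructor <;> nlinarith

lemma sum_le_sum_of_injOn {α β : Type*} [DecidableEq β] (s : Finset α) (t : Finset β)
    (f : α → ℝ) (g : β → ℝ) (i : α → β) (hi : ∀ a ∈ s, i a ∈ t) (hinj : Set.InjOn i s)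
    (hfg : ∀ a ∈ s, f a ≤ g (i a)) (hg : ∀ b ∈ t, 0 ≤ g b) : ∑ a ∈ s, f a ≤ ∑ b ∈ t, g b :=
  calc ∑ a ∈ s, f a ≤ ∑ a ∈ s, g (i a) := sum_le_sum hfg
    _ = ∑ b ∈ s.image i, g b := (sum_image hinj).symm
    _ ≤ ∑ b ∈ t, g b := sum_le_sum_of_subset_of_nonneg (image_subset_iff.2 hi)
        fun b hb _ => hg b hb

/-- The sets of primes with product at most `z`. -/
def primeSets (z : ℕ) : Finset (Finset ℕ) :=
  ((range (z + 1)).filter Nat.Prime).powerset.filter (fun T => ∏ p ∈ T, p ≤ z)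

lemma mem_primeSets {z : ℕ} {T : Finset ℕ} :
    T ∈ primeSets z ↔ (∀ p ∈ T, p.Prime) ∧ ∏ p ∈ T, p ≤ z := by
  simp only [primeSets, mem_filter, mem_powerset, subset_iff, mem_range]
  refine ⟨fun h => ⟨fun p hp => (h.1 hp).2, h.2⟩, fun h => ⟨fun p hp => ⟨?_, h.1 p hp⟩, h.2⟩⟩
  have h1 : p ∣ ∏ p ∈ T, p := dvd_prod_of_mem _ hp
  have h2 := Nat.le_of_dvd (prod_pos fun q hq => (h.1 q hq).pos) h1
  omega

lemma prod_pos_of_mem_primeSets {z : ℕ} {T : Finset ℕ} (hT : T ∈ primeSets z) :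
    0 < ∏ p ∈ T, p := prod_pos fun q hq => ((mem_primeSets.1 hT).1 q hq).pos

lemma mem_primeSets_of_subset {z : ℕ} {T U : Finset ℕ} (hT : T ∈ primeSets z) (hU : U ⊆ T) :
    U ∈ primeSets z := by
  have h := mem_primeSets.1 hT
  refine mem_primeSets.2 ⟨fun p hp => h.1 p (hU hp), le_trans ?_ h.2⟩
  exact Nat.le_of_dvd (prod_pos_of_mem_primeSets hT) (prod_dvd_prod_of_subset _ _ _ hU)

lemma injOn_prod_primeSets (z : ℕ) : Set.InjOn (fun T : Finset ℕ => ∏ p ∈ T, p) (primeSets z) := by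
  intro T hT U hU h
  rw [← Nat.primeFactors_prod (mem_primeSets.1 hT).1, ← Nat.primeFactors_prod (mem_primeSets.1 hU).1]
  exact congrArg Nat.primeFactors h

lemma card_primeSets_le (z : ℕ) : (primeSets z).card ≤ z := by
  have : (primeSets z).card ≤ (Finset.Icc 1 z).card :=
    card_le_card_of_injOn (fun T : Finset ℕ => ∏ p ∈ T, p)
      (fun T hT => by
        rw [coe_Icc]; exact ⟨prod_pos_of_mem_primeSets hT, (mem_primeSets.1 hT).2⟩)
      (injOn_prod_primeSets z)
  simpa using this

lemma rootCount_pos (h p : ℕ) : 1 ≤ rootCount h p := by unfold rootCount; split_ifs <;> simp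

lemma rootCount_lt (h p : ℕ) (hh : 2 ∣ h) (hp : p.Prime) : rootCount h p < p := by
  unfold rootCount
  have := hp.two_le
  split_ifs with hd
  · omega
  · rcases this.eq_or_lt with h2 | h2
    · exact absurd (h2 ▸ hh) hd
    · exact h2

/-- Selberg's upper bound for the number of `n < N` such that `n (n + h)` has no prime factor
up to `z`. -/
lemma card_sifted_le (z N h : ℕ) (hz : 1 ≤ z) (hh : 2 ∣ h) :
    (((range N).filter (fun n => ∀ p ∈ (range (z + 1)).filter Nat.Prime, ¬ p ∣ n * (n + h))).card : ℝ) ≤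
      N / (∑ T ∈ primeSets z, ∏ p ∈ T, 1 / ((p : ℝ) / rootCount h p - 1)) + (z : ℝ) ^ 6 := by
  set f : ℕ → ℝ := fun p => (p : ℝ) / rootCount h p with hf
  have hempty : ∅ ∈ primeSets z := mem_primeSets.2 ⟨by simp, by simpa using hz⟩
  have hf1 : ∀ T ∈ primeSets z, ∀ p ∈ T, 1 < f p := by
    intro T hT p hp
    have h1 := rootCount_lt h p hh ((mem_primeSets.1 hT).1 p hp)
    have h2 := rootCount_pos h p
    rw [hf]
    simp only
    rw [one_lt_div (by exact_mod_cast h2)]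
    exact_mod_cast h1
  obtain ⟨w, hw1, hwb, hwq⟩ := exists_selberg_weights (primeSets z) hempty
    (fun T hT U hU => mem_primeSets_of_subset hT hU) f hf1
  have hwz : ∀ T ∈ primeSets z, |w T| ≤ z := by
    intro T hT
    refine (hwb T hT).trans ?_
    have h1 : ∏ p ∈ T, f p ≤ ∏ p ∈ T, (p : ℝ) := by
      refine prod_le_prod (fun p hp => by have := hf1 T hT p hp; linarith) fun p hp => ?_
      exact div_le_self (by positivity) (by exact_mod_cast rootCount_pos h p)
    have h2 : ((∏ p ∈ T, p : ℕ) : ℝ) ≤ z := by exact_mod_cast (mem_primeSets.1 hT).2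
    rw [Nat.cast_prod] at h2
    exact h1.trans h2
  have hpt : ∀ n, (if ∀ p ∈ (range (z + 1)).filter Nat.Prime, ¬ p ∣ n * (n + h) then (1 : ℝ) else 0)
      ≤ ∑ T ∈ primeSets z, ∑ U ∈ primeSets z, w T * w U *
        (if ∀ p ∈ T ∪ U, p ∣ n * (n + h) then (1 : ℝ) else 0) := by
    intro n
    have e : ∑ T ∈ primeSets z, ∑ U ∈ primeSets z, w T * w U *
        (if ∀ p ∈ T ∪ U, p ∣ n * (n + h) then (1 : ℝ) else 0)
        = (∑ T ∈ primeSets z, w T * (if ∀ p ∈ T, p ∣ n * (n + h) then (1 : ℝ) else 0)) ^ 2 := by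
      rw [sq, sum_mul_sum]
      refine sum_congr rfl fun T _ => sum_congr rfl fun U _ => ?_
      simp only [mem_union, or_imp, forall_and]
      rw [mul_mul_mul_comm, ite_and, ite_zero_mul_ite_zero, mul_one, ite_and]
    rw [e]
    split_ifs with hn
    · rw [sum_eq_single_of_mem ∅ hempty]
      · simp [hw1]
      · intro T hT hTne
        obtain ⟨p, hp⟩ := nonempty_iff_ne_empty.2 hTne
        have hpp := (mem_primeSets.1 hT).1 p hp
        have hpz : p ≤ z := (Nat.le_of_dvd (prod_pos_of_mem_primeSets hT)
          (dvd_prod_of_mem _ hp)).trans (mem_primeSets.1 hT).2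
        rw [if_neg fun h' => hn p (mem_filter.2 ⟨mem_range.2 (by omega), hpp⟩) (h' p hp), mul_zero]
    · positivity
  have hcount : ∀ T ∈ primeSets z, ∀ U ∈ primeSets z,
      w T * w U * (((range N).filter (fun n => ∀ p ∈ T ∪ U, p ∣ n * (n + h))).card : ℝ)
        ≤ N * (w T * w U / ∏ p ∈ T ∪ U, f p) + (z : ℝ) ^ 4 := by
    intro T hT U hU
    have hTU : ∀ p ∈ T ∪ U, p.Prime := fun p hp => (mem_union.1 hp).elim
      ((mem_primeSets.1 hT).1 p) ((mem_primeSets.1 hU).1 p)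
    have h1 := abs_card_common_roots_sub_le h N (T ∪ U) hTU
    have h2 : ∏ p ∈ T ∪ U, (rootCount h p : ℝ) ≤ (z : ℝ) ^ 2 := by
      have g1 : ∏ p ∈ T ∪ U, rootCount h p ≤ ∏ p ∈ T ∪ U, p :=
        prod_le_prod' fun p hp => (rootCount_lt h p hh (hTU p hp)).le
      have g2 : ∏ p ∈ T ∪ U, p ≤ (∏ p ∈ T, p) * ∏ p ∈ U, p := by
        rw [← prod_union_inter]
        exact Nat.le_mul_of_pos_right _
          (prod_pos fun p hp => ((mem_primeSets.1 hT).1 p (mem_inter.1 hp).1).pos)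
      have g3 : (∏ p ∈ T, p) * ∏ p ∈ U, p ≤ z ^ 2 := by
        rw [sq]; exact Nat.mul_le_mul (mem_primeSets.1 hT).2 (mem_primeSets.1 hU).2
      exact_mod_cast g1.trans (g2.trans g3)
    have h3 : |w T * w U| ≤ (z : ℝ) ^ 2 := by
      rw [abs_mul, sq]
      exact mul_le_mul (hwz T hT) (hwz U hU) (abs_nonneg _) (by positivity)
    have h4 := mul_le_mul h3 (h1.trans h2) (abs_nonneg _) (by positivity)
    rw [← abs_mul] at h4
    have h5 := (le_abs_self _).trans h4
    have h6 : N * (w T * w U / ∏ p ∈ T ∪ U, f p) = w T * w U * (N / ∏ p ∈ T ∪ U, f p) := by ring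
    rw [h6]
    nlinarith
  calc (((range N).filter (fun n => ∀ p ∈ (range (z + 1)).filter Nat.Prime, ¬ p ∣ n * (n + h))).card : ℝ)
      = ∑ n ∈ range N, (if ∀ p ∈ (range (z + 1)).filter Nat.Prime, ¬ p ∣ n * (n + h) then (1 : ℝ) else 0) := by
        rw [sum_boole]
    _ ≤ ∑ n ∈ range N, ∑ T ∈ primeSets z, ∑ U ∈ primeSets z, w T * w U *
        (if ∀ p ∈ T ∪ U, p ∣ n * (n + h) then (1 : ℝ) else 0) := sum_le_sum fun n _ => hpt n
    _ = ∑ T ∈ primeSets z, ∑ U ∈ primeSets z, w T * w U *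
        (((range N).filter (fun n => ∀ p ∈ T ∪ U, p ∣ n * (n + h))).card : ℝ) := by
        rw [sum_comm]
        refine sum_congr rfl fun T _ => ?_
        rw [sum_comm]
        refine sum_congr rfl fun U _ => ?_
        rw [← mul_sum, sum_boole]
    _ ≤ ∑ T ∈ primeSets z, ∑ U ∈ primeSets z, (N * (w T * w U / ∏ p ∈ T ∪ U, f p) + (z : ℝ) ^ 4) :=
        sum_le_sum fun T hT => sum_le_sum fun U hU => hcount T hT U hU
    _ = N * (1 / ∑ T ∈ primeSets z, ∏ p ∈ T, 1 / (f p - 1))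
        + ((primeSets z).card : ℝ) ^ 2 * (z : ℝ) ^ 4 := by
        rw [← hwq, mul_sum]
        simp only [sum_add_distrib, mul_sum, sum_const, nsmul_eq_mul]
        ring
    _ ≤ _ := by
        have hc : ((primeSets z).card : ℝ) ≤ z := by exact_mod_cast card_primeSets_le z
        rw [mul_one_div]
        have : (z : ℝ) ^ 6 = (z : ℝ) ^ 2 * (z : ℝ) ^ 4 := by ring
        rw [this]
        gcongr

lemma sum_primeSets_two_div_le (z h : ℕ) (hh : 2 ∣ h) (hh0 : h ≠ 0) :
    ∑ T ∈ primeSets z, ∏ p ∈ T, (2 / p : ℝ) ≤ (∏ p ∈ h.primeFactors, (1 + 1 / p : ℝ))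
      * ∑ T ∈ primeSets z, ∏ p ∈ T, 1 / ((p : ℝ) / rootCount h p - 1) := by
  have h1 : ∀ T ∈ primeSets z, ∏ p ∈ T, (2 / p : ℝ) = ∑ E ∈ T.powerset,
      (∏ p ∈ E, (if p ∣ h then 1 / (p : ℝ) else 0)) * ∏ p ∈ T \ E, (rootCount h p / p : ℝ) := by
    intro T _
    rw [← prod_add]
    refine prod_congr rfl fun p _ => ?_
    unfold rootCount
    split_ifs
    · push_cast; ring
    · push_cast; ring
  have h2 : ∑ T ∈ primeSets z, ∏ p ∈ T, (2 / p : ℝ)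
      ≤ ∑ x ∈ (primeSets z ×ˢ h.primeFactors.powerset),
        (∏ p ∈ x.2, 1 / (p : ℝ)) * ∏ p ∈ x.1, (rootCount h p / p : ℝ) := by
    rw [sum_congr rfl h1, sum_sigma']
    have h3 : ∀ x ∈ (primeSets z).sigma (fun T => T.powerset), ¬ x.2 ⊆ h.primeFactors →
      (∏ p ∈ x.2, (if p ∣ h then 1 / (p : ℝ) else 0))
        * ∏ p ∈ x.1 \ x.2, (rootCount h p / p : ℝ) = 0 := by
      intro x hx hn
      rw [mem_sigma, mem_powerset] at hx
      obtain ⟨p, hp, hp2⟩ := not_subset.1 hn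
      have hpd : ¬ p ∣ h := fun hd =>
        hp2 (Nat.mem_primeFactors.2 ⟨(mem_primeSets.1 hx.1).1 p (hx.2 hp), hd, hh0⟩)
      rw [prod_eq_zero hp (if_neg hpd), zero_mul]
    rw [← sum_filter_of_ne (p := fun x => x.2 ⊆ h.primeFactors)
      (fun x hx hne => by by_contra hc; exact hne (h3 x hx hc))]
    refine sum_le_sum_of_injOn _ _ _ _ (fun x => (x.1 \ x.2, x.2)) ?_ ?_ ?_ ?_
    · intro x hx
      simp only [mem_filter, mem_sigma, mem_powerset, mem_product] at hx ⊢
      exact ⟨mem_primeSets_of_subset hx.1.1 sdiff_subset, hx.2⟩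
    · rintro ⟨x1, x2⟩ hx ⟨y1, y2⟩ hy hxy
      simp only [coe_filter, mem_sigma, mem_powerset, Set.mem_ofPred_eq, Prod.mk.injEq] at hx hy hxy
      obtain ⟨hxy1, rfl⟩ := hxy
      have : x1 = y1 := by
        rw [← sdiff_union_of_subset hx.1.2, hxy1, sdiff_union_of_subset hy.1.2]
      subst this
      rfl
    · intro x hx
      simp only [mem_filter, mem_sigma, mem_powerset] at hx
      rw [prod_congr rfl fun p hp => if_pos (Nat.dvd_of_mem_primeFactors (hx.2 hp))]
    · intro x _
      positivity
  refine h2.trans ?_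
  rw [sum_product_right, prod_one_add, sum_mul]
  refine sum_le_sum fun E _ => ?_
  dsimp only
  rw [← mul_sum]
  refine mul_le_mul_of_nonneg_left (sum_le_sum fun T hT => ?_) (by positivity)
  refine prod_le_prod (fun p _ => by positivity) fun p hp => ?_
  have g1 := rootCount_lt h p hh ((mem_primeSets.1 hT).1 p hp)
  have g2 := rootCount_pos h p
  have g1' : (rootCount h p : ℝ) < p := by exact_mod_cast g1
  have g2' : (0 : ℝ) < rootCount h p := by exact_mod_cast g2
  have g3 : (p : ℝ) / rootCount h p - 1 = (p - rootCount h p) / rootCount h p := by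
    field_simp
  rw [g3, one_div_div]
  have : 0 < (p : ℝ) - rootCount h p := by linarith
  gcongr
  linarith

lemma sum_Icc_one_div_sq_le (n : ℕ) : ∑ b ∈ Finset.Icc 1 n, 1 / (b : ℝ) ^ 2 ≤ 2 := by
  rcases Nat.eq_zero_or_pos n with rfl | hn
  · simp
  have : ∑ b ∈ Finset.Icc 1 n, 1 / (b : ℝ) ^ 2 ≤ 2 - 1 / (n : ℝ) := by
    induction n, hn using Nat.le_induction with
    | base => norm_num
    | succ n hn ih =>
      have hn0 : (0 : ℝ) < n := by exact_mod_cast hn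
      rw [sum_Icc_succ_top (by omega)]
      have : 1 / (((n + 1 : ℕ) : ℝ)) ^ 2 ≤ 1 / n - 1 / ((n + 1 : ℕ) : ℝ) := by
        push_cast
        rw [div_sub_div _ _ (by positivity) (by positivity), div_le_div_iff₀ (by positivity) (by positivity)]
        nlinarith
      linarith
  have h2 : (0 : ℝ) ≤ 1 / (n : ℝ) := by positivity
  linarith

lemma sum_Icc_one_div_le (y : ℕ) :
    ∑ a ∈ Finset.Icc 1 y, 1 / (a : ℝ) ≤ 2 * ∑ T ∈ primeSets y, ∏ p ∈ T, 1 / (p : ℝ) := by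
  choose k b hkb hk using Nat.sq_mul_squarefree
  have h1 : ∑ a ∈ Finset.Icc 1 y, 1 / (a : ℝ)
      ≤ ∑ x ∈ Finset.Icc 1 y ×ˢ primeSets y, 1 / (x.1 : ℝ) ^ 2 * ∏ p ∈ x.2, 1 / (p : ℝ) := by
    refine sum_le_sum_of_injOn _ _ _ _ (fun a => (b a, (k a).primeFactors)) ?_ ?_ ?_ ?_
    · intro a ha
      have ha := Finset.mem_Icc.1 ha
      have hb0 : b a ≠ 0 := by rintro h0; have := hkb a; rw [h0] at this; simp at this; omega
      have hk0 : 0 < k a := Nat.pos_of_ne_zero (hk a).ne_zero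
      have hba : b a ≤ a := by
        calc b a ≤ b a ^ 2 := Nat.le_self_pow (by norm_num) _
          _ ≤ b a ^ 2 * k a := Nat.le_mul_of_pos_right _ hk0
          _ = a := hkb a
      have hka : k a ≤ a := by
        calc k a ≤ b a ^ 2 * k a := Nat.le_mul_of_pos_left _ (by positivity)
          _ = a := hkb a
      simp only [mem_product, Finset.mem_Icc, mem_primeSets]
      refine ⟨⟨by omega, by omega⟩, fun p hp => Nat.prime_of_mem_primeFactors hp, ?_⟩
      rw [Nat.prod_primeFactors_of_squarefree (hk a)]
      omega
    · intro a _ a' _ haa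
      simp only [Prod.mk.injEq] at haa
      rw [← hkb a, ← hkb a', haa.1, ← Nat.prod_primeFactors_of_squarefree (hk a), haa.2,
        Nat.prod_primeFactors_of_squarefree (hk a')]
    · intro a _
      have : (∏ p ∈ (k a).primeFactors, 1 / (p : ℝ)) = 1 / k a := by
        conv_rhs => rw [← Nat.prod_primeFactors_of_squarefree (hk a)]
        rw [prod_div_distrib]
        push_cast
        simp
      simp only [this]
      conv_lhs => rw [← hkb a]
      push_cast
      rw [one_div_mul_one_div]
    · intro x _
      positivity
  rw [sum_product] at h1
  dsimp only at h1
  rw [← sum_mul_sum] at h1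
  refine h1.trans (mul_le_mul_of_nonneg_right (sum_Icc_one_div_sq_le y) (by positivity))

lemma sq_sum_primeSets_le (y : ℕ) :
    (∑ T ∈ primeSets y, ∏ p ∈ T, 1 / (p : ℝ)) ^ 2
      ≤ 2 * ∑ T ∈ primeSets (y ^ 2), ∏ p ∈ T, (2 / p : ℝ) := by
  have h1 : (∑ T ∈ primeSets y, ∏ p ∈ T, 1 / (p : ℝ)) ^ 2
      ≤ ∑ x ∈ primeSets y ×ˢ (primeSets (y ^ 2)).sigma (fun W => W.powerset),
        (∏ p ∈ x.1, 1 / (p : ℝ)) ^ 2 * ∏ p ∈ x.2.1, 1 / (p : ℝ) := by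
    rw [sq, sum_mul_sum, ← sum_product']
    refine sum_le_sum_of_injOn _ _ _ _
      (fun x => (x.1 ∩ x.2, ⟨(x.1 ∪ x.2) \ (x.1 ∩ x.2), x.1 \ x.2⟩)) ?_ ?_ ?_ ?_
    · rintro ⟨T, U⟩ hx
      simp only [mem_product] at hx
      obtain ⟨hT, hU⟩ := hx
      simp only [mem_product, mem_sigma, mem_powerset]
      refine ⟨mem_primeSets_of_subset hT inter_subset_left, ?_, ?_⟩
      · have hTU : T ∪ U ∈ primeSets (y ^ 2) := by
          refine mem_primeSets.2 ⟨fun p hp => (mem_union.1 hp).elim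
            ((mem_primeSets.1 hT).1 p) ((mem_primeSets.1 hU).1 p), ?_⟩
          calc ∏ p ∈ T ∪ U, p ≤ (∏ p ∈ T ∪ U, p) * ∏ p ∈ T ∩ U, p :=
                Nat.le_mul_of_pos_right _
                  (prod_pos fun p hp => ((mem_primeSets.1 hT).1 p (mem_inter.1 hp).1).pos)
            _ = (∏ p ∈ T, p) * ∏ p ∈ U, p := prod_union_inter
            _ ≤ y * y := Nat.mul_le_mul (mem_primeSets.1 hT).2 (mem_primeSets.1 hU).2
            _ = y ^ 2 := (sq y).symm
        exact mem_primeSets_of_subset hTU sdiff_subset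
      · intro p hp
        simp only [mem_sdiff, mem_union, mem_inter] at hp ⊢
        tauto
    · rintro ⟨T, U⟩ _ ⟨T', U'⟩ _ hxy
      simp only [Prod.mk.injEq, Sigma.mk.injEq, heq_eq_eq] at hxy
      obtain ⟨hi, hu, hd⟩ := hxy
      have hU : ∀ T U : Finset ℕ, U = (((T ∪ U) \ (T ∩ U)) \ (T \ U)) ∪ (T ∩ U) := by
        intro T U
        ext p
        by_cases hT : p ∈ T <;> by_cases hU : p ∈ U <;> simp [hT, hU]
      rw [Prod.mk.injEq]
      constructor
      · rw [← sdiff_union_inter T U, hd, hi, sdiff_union_inter]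
      · rw [hU T U, hu, hd, hi, ← hU T' U']
    · rintro ⟨T, U⟩ _
      dsimp only
      rw [← prod_union_inter, ← prod_sdiff (inter_subset_union (s := T) (t := U))]
      exact le_of_eq (by ring)
    · intro x _
      positivity
  refine h1.trans ?_
  rw [sum_product]
  dsimp only
  rw [← sum_mul_sum]
  refine mul_le_mul ?_ ?_ (by positivity) (by norm_num)
  · refine le_trans ?_ (sum_Icc_one_div_sq_le y)
    refine sum_le_sum_of_injOn _ _ _ _ (fun T => ∏ p ∈ T, p) ?_ (injOn_prod_primeSets y) ?_ ?_
    · exact fun T hT => Finset.mem_Icc.2 ⟨prod_pos_of_mem_primeSets hT, (mem_primeSets.1 hT).2⟩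
    · intro T _
      push_cast
      rw [prod_div_distrib, prod_const_one, div_pow, one_pow]
    · intro b _
      positivity
  · rw [sum_sigma]
    refine le_of_eq (sum_congr rfl fun T _ => ?_)
    dsimp only
    rw [sum_const, card_powerset, nsmul_eq_mul]
    simp only [div_eq_mul_inv, prod_mul_distrib, prod_const, one_pow]
    push_cast
    ring

lemma log_sq_le_sum_primeSets (y : ℕ) :
    Real.log (y + 1) ^ 2 / 8 ≤ ∑ T ∈ primeSets (y ^ 2), ∏ p ∈ T, (2 / p : ℝ) := by
  have h1 : Real.log (y + 1) ≤ ∑ a ∈ Finset.Icc 1 y, 1 / (a : ℝ) := by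
    have h := log_add_one_le_harmonic y
    rw [harmonic_eq_sum_Icc] at h
    push_cast at h
    simpa using h
  have h2 := h1.trans (sum_Icc_one_div_le y)
  have h3 := sq_sum_primeSets_le y
  have h0 : 0 ≤ Real.log (y + 1) := Real.log_nonneg (by linarith [(Nat.cast_nonneg y : (0:ℝ) ≤ y)])
  have h4 := pow_le_pow_left₀ h0 h2 2
  rw [mul_pow] at h4
  linarith

lemma card_twin_le_of_even (y N h : ℕ) (hy : 1 ≤ y) (hh : 2 ∣ h) (hh0 : h ≠ 0) :
    (((range N).filter (fun n => n.Prime ∧ (n + h).Prime)).card : ℝ) ≤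
      8 * N / Real.log (y + 1) ^ 2 * (∏ p ∈ h.primeFactors, (1 + 1 / p : ℝ))
        + (y : ℝ) ^ 12 + (y : ℝ) ^ 2 + 1 := by
  set z := y ^ 2 with hz
  have hz1 : 1 ≤ z := Nat.one_le_pow _ _ hy
  have hsub : (range N).filter (fun n => n.Prime ∧ (n + h).Prime) ⊆
      (range N).filter (fun n => ∀ p ∈ (range (z + 1)).filter Nat.Prime, ¬ p ∣ n * (n + h))
        ∪ range (z + 1) := by
    intro n hn
    simp only [mem_filter, mem_range, mem_union] at hn ⊢
    rcases Nat.lt_or_ge n (z + 1) with hlt | hge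
    · exact Or.inr hlt
    · refine Or.inl ⟨hn.1, fun p hp hd => ?_⟩
      rcases (hp.2.dvd_mul).1 hd with hd | hd
      · have := (Nat.prime_dvd_prime_iff_eq hp.2 hn.2.1).1 hd
        omega
      · have := (Nat.prime_dvd_prime_iff_eq hp.2 hn.2.2).1 hd
        omega
  have hc := (card_le_card hsub).trans (card_union_le _ _)
  rw [card_range] at hc
  have hc' : (((range N).filter (fun n => n.Prime ∧ (n + h).Prime)).card : ℝ) ≤
      (((range N).filter (fun n => ∀ p ∈ (range (z + 1)).filter Nat.Prime,
        ¬ p ∣ n * (n + h))).card : ℝ) + (z + 1) := by exact_mod_cast hc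
  have h1 := card_sifted_le z N h hz1 hh
  have h2 := sum_primeSets_two_div_le z h hh hh0
  have h3 := log_sq_le_sum_primeSets y
  rw [← hz] at h3
  set S := ∑ T ∈ primeSets z, ∏ p ∈ T, 1 / ((p : ℝ) / rootCount h p - 1)
  set G := ∏ p ∈ h.primeFactors, (1 + 1 / p : ℝ) with hG
  have hlog : 0 < Real.log (y + 1) := Real.log_pos (by
    have : (1 : ℝ) ≤ y := by exact_mod_cast hy
    linarith)
  have hG0 : 0 < G := prod_pos fun p _ => by positivity
  have h4 := h3.trans h2
  have hS : 0 < S := by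
    by_contra hS
    have : 0 < Real.log (y + 1) ^ 2 / 8 := by positivity
    nlinarith
  have h5 : (N : ℝ) / S ≤ 8 * N / Real.log (y + 1) ^ 2 * G := by
    rw [div_mul_eq_mul_div, div_le_div_iff₀ hS (by positivity)]
    have := mul_le_mul_of_nonneg_left h4 (Nat.cast_nonneg N : (0 : ℝ) ≤ N)
    nlinarith
  have h6 : (z : ℝ) ^ 6 = (y : ℝ) ^ 12 := by rw [hz]; push_cast; ring
  have h7 : (z : ℝ) = (y : ℝ) ^ 2 := by rw [hz]; push_cast; ring
  rw [h6] at h1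
  rw [h7] at hc'
  linarith

lemma one_le_prod_one_add_one_div (S : Finset ℕ) : (1 : ℝ) ≤ ∏ p ∈ S, (1 + 1 / p : ℝ) :=
  le_of_eq_of_le prod_const_one.symm (prod_le_prod (fun _ _ => zero_le_one) fun p _ => by
    have : (0 : ℝ) ≤ 1 / p := by positivity
    linarith)

/-- The number of prime pairs `n, n + h` with `n ≤ X` is `≪ X / log² X * ∏_{p ∣ h} (1 + 1/p)`. -/
lemma card_twin_le (X h : ℕ) (hX : 2 ≤ X) (hh0 : h ≠ 0) :
    (((range (X + 1)).filter (fun n => n.Prime ∧ (n + h).Prime)).card : ℝ) ≤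
      10000 * X / Real.log X ^ 2 * ∏ p ∈ h.primeFactors, (1 + 1 / p : ℝ) := by
  have hX2 : (2 : ℝ) ≤ X := by exact_mod_cast hX
  have hX0 : (0 : ℝ) < X := by linarith
  have hL : 0 < Real.log X := Real.log_pos (by linarith)
  have hG := one_le_prod_one_add_one_div h.primeFactors
  set G := ∏ p ∈ h.primeFactors, (1 + 1 / p : ℝ) with hGdef
  set H : ℝ := (X : ℝ) ^ (1 / 2 : ℝ) with hH
  have hH1 : 1 ≤ H := Real.one_le_rpow (by linarith) (by norm_num)
  have hHL : H ≤ 16 * X / Real.log X ^ 2 := by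
    have h1 := Real.log_le_rpow_div hX0.le (ε := 1 / 4) (by norm_num)
    have h2 := pow_le_pow_left₀ hL.le h1 2
    rw [div_pow, ← Real.rpow_natCast (_ ^ _), ← Real.rpow_mul hX0.le] at h2
    have h3 : (1 / 4 : ℝ) * ((2 : ℕ) : ℝ) = 1 / 2 := by norm_num
    rw [h3, ← hH] at h2
    have h4 : H * H = X := by
      rw [hH, ← Real.rpow_add hX0]; norm_num
    rw [le_div_iff₀ (by positivity)]
    calc H * Real.log X ^ 2 ≤ H * (H / (1 / 4) ^ 2) :=
          mul_le_mul_of_nonneg_left h2 (zero_le_one.trans hH1)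
      _ = 16 * (H * H) := by ring
      _ = 16 * X := by rw [h4]
  by_cases hh : 2 ∣ h
  · set y := ⌊(X : ℝ) ^ (1 / 24 : ℝ)⌋₊ with hy
    have hyle : (y : ℝ) ≤ (X : ℝ) ^ (1 / 24 : ℝ) := Nat.floor_le (by positivity)
    have hy1 : 1 ≤ y := Nat.le_floor (by
      push_cast
      exact Real.one_le_rpow (by linarith) (by norm_num))
    have hy12 : (y : ℝ) ^ 12 ≤ H := by
      have h1 := pow_le_pow_left₀ (by positivity) hyle 12
      rw [← Real.rpow_natCast (_ ^ _), ← Real.rpow_mul hX0.le] at h1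
      have h3 : (1 / 24 : ℝ) * ((12 : ℕ) : ℝ) = 1 / 2 := by norm_num
      rwa [h3] at h1
    have hy2 : (y : ℝ) ^ 2 ≤ H :=
      le_trans (pow_le_pow_right₀ (by exact_mod_cast hy1) (by norm_num)) hy12
    have hlog : Real.log X / 24 ≤ Real.log (y + 1) := by
      have h1 : (X : ℝ) ^ (1 / 24 : ℝ) ≤ y + 1 := (Nat.lt_floor_add_one _).le
      have h2 := Real.log_le_log (by positivity) h1
      rw [Real.log_rpow hX0] at h2
      linarith
    have h1 := card_twin_le_of_even y (X + 1) h hy1 hh hh0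
    have h2 : 8 * ((X + 1 : ℕ) : ℝ) / Real.log (y + 1) ^ 2 * G
        ≤ 9216 * (X / Real.log X ^ 2) * G := by
      refine mul_le_mul_of_nonneg_right ?_ (by linarith)
      have h3 := pow_le_pow_left₀ (by positivity) hlog 2
      calc 8 * ((X + 1 : ℕ) : ℝ) / Real.log (y + 1) ^ 2
          ≤ 16 * X / (Real.log X / 24) ^ 2 := by
            refine div_le_div₀ (by positivity) ?_ (by positivity) h3
            push_cast; linarith
        _ = _ := by field_simp; norm_num
    have h4 : 48 * (X / Real.log X ^ 2) ≤ 48 * (X / Real.log X ^ 2) * G :=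
      le_mul_of_one_le_right (by positivity) hG
    have h5 : 10000 * X / Real.log X ^ 2 * G = 10000 * (X / Real.log X ^ 2 * G) := by ring
    have h6 : 16 * X / Real.log X ^ 2 = 16 * (X / Real.log X ^ 2) := by ring
    have h7 : 0 ≤ X / Real.log X ^ 2 * G := by positivity
    rw [h5]
    rw [h6] at hHL
    linarith
  · have hcard : ((range (X + 1)).filter (fun n => n.Prime ∧ (n + h).Prime)).card ≤ 1 := by
      rw [← card_singleton 2]
      refine card_le_card fun n hn => ?_
      rw [mem_filter] at hn
      rw [mem_singleton]
      rcases hn.2.1.eq_two_or_odd with h2 | h2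
      · exact h2
      · rcases hn.2.2.eq_two_or_odd with h3 | h3
        · have := hn.2.1.two_le
          omega
        · omega
    calc (((range (X + 1)).filter (fun n => n.Prime ∧ (n + h).Prime)).card : ℝ) ≤ 1 := by
          exact_mod_cast hcard
      _ ≤ 16 * X / Real.log X ^ 2 := hH1.trans hHL
      _ ≤ 10000 * X / Real.log X ^ 2 := by gcongr; norm_num
      _ ≤ _ := le_mul_of_one_le_right (by positivity) hG

lemma card_primeFactors_le_log (n : ℕ) : n.primeFactors.card ≤ Nat.log 2 n := by
  rcases Nat.eq_zero_or_pos n with rfl | hn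
  · simp
  · refine Nat.le_log_of_pow_le (by norm_num) ?_
    calc 2 ^ n.primeFactors.card ≤ ∏ p ∈ n.primeFactors, p :=
          pow_card_le_prod _ _ _ fun p hp => (Nat.prime_of_mem_primeFactors hp).two_le
      _ ≤ n := Nat.le_of_dvd hn (Nat.prod_primeFactors_dvd n)

lemma prod_one_add_one_div_le_exp (S : Finset ℕ) (m : ℝ) (hm : 0 < m) (hS : ∀ p ∈ S, m ≤ p) :
    ∏ p ∈ S, (1 + 1 / p : ℝ) ≤ Real.exp (S.card / m) :=
  calc ∏ p ∈ S, (1 + 1 / p : ℝ) ≤ ∏ _p ∈ S, Real.exp (1 / m) := by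
        refine prod_le_prod (fun p _ => by positivity) fun p hp => ?_
        have h1 := one_div_le_one_div_of_le hm (hS p hp)
        have h2 := Real.add_one_le_exp (1 / m)
        linarith
    _ = Real.exp (S.card / m) := by
        rw [prod_const, ← Real.exp_nat_mul]
        ring_nf

lemma card_primes_dyadic_le (j : ℕ) (hj : 1 ≤ j) :
    (((Finset.Ioc (2 ^ j) (2 ^ (j + 1))).filter Nat.Prime).card : ℝ) / 2 ^ j ≤ 4 / j := by
  have h1 : (2 ^ j) ^ ((Finset.Ioc (2 ^ j) (2 ^ (j + 1))).filter Nat.Prime).card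
      ≤ 4 ^ (2 ^ (j + 1)) := by
    refine le_trans (pow_card_le_prod _ (fun p => p) _ fun p hp => ?_) (le_trans ?_
      (primorial_le_four_pow (2 ^ (j + 1))))
    · exact (Finset.mem_Ioc.1 (mem_filter.1 hp).1).1.le
    · rw [primorial]
      refine prod_le_prod_of_subset_of_one_le' (fun p hp => ?_) fun p hp _ => ?_
      · rw [mem_filter, Finset.mem_Ioc] at hp
        exact mem_filter.2 ⟨mem_range.2 (by omega), hp.2⟩
      · exact (mem_filter.1 hp).2.one_le
  have h4 : (4 : ℕ) = 2 ^ 2 := by norm_num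
  rw [h4, ← pow_mul, ← pow_mul] at h1
  have h2 := (Nat.pow_le_pow_iff_right (by norm_num)).1 h1
  have hj0 : (0 : ℝ) < j := by exact_mod_cast hj
  rw [div_le_div_iff₀ (by positivity) hj0]
  have h3 : ((j * ((Finset.Ioc (2 ^ j) (2 ^ (j + 1))).filter Nat.Prime).card : ℕ) : ℝ)
      ≤ ((2 * 2 ^ (j + 1) : ℕ) : ℝ) := by exact_mod_cast h2
  push_cast at h3
  have h5 : (2 : ℝ) ^ (j + 1) = 2 * 2 ^ j := pow_succ' _ _
  linarith

lemma prod_primes_le_exp (J : ℕ) :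
    ∏ p ∈ (range (2 ^ J + 1)).filter Nat.Prime, (1 + 1 / p : ℝ)
      ≤ 2 * Real.exp (8 * ∑ j ∈ Finset.Icc 1 J, 1 / (j : ℝ)) := by
  have hsplit : ∀ J, ∏ p ∈ (range (2 ^ (J + 1) + 1)).filter Nat.Prime, (1 + 1 / p : ℝ)
      = (∏ p ∈ (range (2 ^ J + 1)).filter Nat.Prime, (1 + 1 / p : ℝ))
        * ∏ p ∈ (Finset.Ioc (2 ^ J) (2 ^ (J + 1))).filter Nat.Prime, (1 + 1 / p : ℝ) := by
    intro J
    rw [← prod_union]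
    · refine prod_congr ?_ fun _ _ => rfl
      have := Nat.pow_le_pow_right (n := 2) (by norm_num) (Nat.le_succ J)
      ext p
      simp only [mem_filter, mem_union, mem_range, Finset.mem_Ioc]
      rw [← or_and_right]
      refine and_congr_left fun _ => ?_
      rw [Nat.succ_eq_add_one] at this
      omega
    · rw [disjoint_left]
      intro p hp hp'
      simp only [mem_filter, mem_range, Finset.mem_Ioc] at hp hp'
      omega
  induction J with
  | zero =>
    have : (range (2 ^ 0 + 1)).filter Nat.Prime = ∅ := by decide
    rw [this]
    simp
  | succ J ih =>
    rw [hsplit, sum_Icc_succ_top (by omega), mul_add, Real.exp_add]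
    rcases Nat.eq_zero_or_pos J with rfl | hJ
    · have h0 : (range (2 ^ 0 + 1)).filter Nat.Prime = ∅ := by decide
      have h1 : (Finset.Ioc (2 ^ 0) (2 ^ (0 + 1))).filter Nat.Prime = {2} := by decide
      rw [h0, h1]
      have h2 : (1 : ℝ) ≤ Real.exp 8 := Real.one_le_exp (by norm_num)
      simp only [prod_empty, prod_singleton]
      norm_num
      linarith
    · rw [← mul_assoc]
      refine mul_le_mul ih ?_ (by positivity) (by positivity)
      refine (prod_one_add_one_div_le_exp _ (2 ^ J) (by positivity) fun p hp => ?_).trans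
        (Real.exp_le_exp.2 ((card_primes_dyadic_le J hJ).trans ?_))
      · have := (Finset.mem_Ioc.1 (mem_filter.1 hp).1).1.le
        exact_mod_cast this
      · have hJ1 : (1 : ℝ) ≤ J := by exact_mod_cast hJ
        rw [mul_one_div, div_le_div_iff₀ (by positivity) (by positivity)]
        push_cast
        linarith

lemma prod_primes_le_pow (J : ℕ) :
    ∏ p ∈ (range (2 ^ J + 1)).filter Nat.Prime, (1 + 1 / p : ℝ)
      ≤ 2 * Real.exp 8 * ((J : ℝ) + 1) ^ 8 := by
  refine (prod_primes_le_exp J).trans ?_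
  rw [mul_assoc]
  refine mul_le_mul_of_nonneg_left ?_ (by norm_num)
  have h := harmonic_le_one_add_log J
  rw [harmonic_eq_sum_Icc] at h
  push_cast at h
  have h1 : Real.log J ≤ Real.log (J + 1) := by
    rcases Nat.eq_zero_or_pos J with rfl | hJ
    · simp
    · have hJ0 : (0 : ℝ) < J := by exact_mod_cast hJ
      exact Real.log_le_log hJ0 (by linarith)
  have h2 : Real.exp (8 + 8 * Real.log (J + 1)) = Real.exp 8 * ((J : ℝ) + 1) ^ 8 := by
    rw [Real.exp_add]
    congr 1
    have h3 : (8 : ℝ) * Real.log (J + 1) = ((8 : ℕ) : ℝ) * Real.log (J + 1) := by norm_num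
    rw [h3, Real.exp_nat_mul, Real.exp_log (by positivity)]
  rw [← h2]
  refine Real.exp_le_exp.2 ?_
  simp only [one_div]
  linarith

lemma orderOf_two_pos (n : ℕ) (hn : n ≠ 0) (hcop : Nat.Coprime 2 n) :
    0 < orderOf (2 : ZMod n) := by
  refine orderOf_pos_iff.2 (isOfFinOrder_iff_pow_eq_one.2
    ⟨n.totient, Nat.totient_pos.2 (Nat.pos_of_ne_zero hn), ?_⟩)
  have h := (ZMod.natCast_eq_natCast_iff _ _ n).2 (Nat.ModEq.pow_totient hcop)
  simpa using h

lemma card_le_sq_of_orderOf_le (Q : Finset ℕ) (hQ : ∀ p ∈ Q, p.Prime ∧ p ≠ 2) (y : ℕ)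
    (hy : ∀ p ∈ Q, orderOf (2 : ZMod p) ≤ y) : Q.card ≤ y ^ 2 := by
  have hsub : Q ⊆ (Finset.Icc 1 y).biUnion fun m => (2 ^ m - 1).primeFactors := by
    intro p hp
    have hpp := (hQ p hp).1
    have hcop : Nat.Coprime 2 p :=
      (Nat.coprime_primes Nat.prime_two hpp).2 (hQ p hp).2.symm
    have hpos := orderOf_two_pos p hpp.ne_zero hcop
    refine mem_biUnion.2 ⟨orderOf (2 : ZMod p), Finset.mem_Icc.2 ⟨hpos, hy p hp⟩, ?_⟩
    have h1 : 1 < 2 ^ orderOf (2 : ZMod p) := Nat.one_lt_two_pow hpos.ne'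
    refine Nat.mem_primeFactors.2 ⟨hpp, ?_, by omega⟩
    rw [← Nat.modEq_iff_dvd' h1.le, ← ZMod.natCast_eq_natCast_iff]
    push_cast
    exact (pow_orderOf_eq_one (2 : ZMod p)).symm
  calc Q.card ≤ ∑ m ∈ Finset.Icc 1 y, (2 ^ m - 1).primeFactors.card :=
        (card_le_card hsub).trans card_biUnion_le
    _ ≤ ∑ _m ∈ Finset.Icc 1 y, y := by
        refine sum_le_sum fun m hm => ?_
        refine (card_primeFactors_le_log _).trans ?_
        have h1 : Nat.log 2 (2 ^ m - 1) ≤ Nat.log 2 (2 ^ m) := Nat.log_mono_right (Nat.sub_le _ _)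
        rw [Nat.log_pow (by norm_num)] at h1
        exact h1.trans (Finset.mem_Icc.1 hm).2
    _ = y ^ 2 := by simp [sq]

lemma prod_le_of_orderOf_le (Q : Finset ℕ) (hQ : ∀ p ∈ Q, p.Prime ∧ p ≠ 2) (J : ℕ)
    (hJ : ∀ p ∈ Q, orderOf (2 : ZMod p) ≤ 2 ^ J) :
    ∏ p ∈ Q, (1 + 1 / p : ℝ) ≤ 2 * Real.exp 9 * (2 * (J : ℝ) + 1) ^ 8 := by
  have h1 : ∏ p ∈ Q.filter (fun p => p ≤ 2 ^ (2 * J)), (1 + 1 / p : ℝ)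
      ≤ 2 * Real.exp 8 * (2 * (J : ℝ) + 1) ^ 8 := by
    have h := prod_primes_le_pow (2 * J)
    push_cast at h
    refine le_trans ?_ h
    refine prod_le_prod_of_subset_of_one_le (fun p hp => ?_) (fun p _ => by positivity)
      fun p _ _ => ?_
    · rw [mem_filter] at hp
      exact mem_filter.2 ⟨mem_range.2 (by omega), (hQ p hp.1).1⟩
    · have : (0 : ℝ) ≤ 1 / p := by positivity
      linarith
  have h2 : ∏ p ∈ Q.filter (fun p => ¬ p ≤ 2 ^ (2 * J)), (1 + 1 / p : ℝ) ≤ Real.exp 1 := by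
    refine (prod_one_add_one_div_le_exp _ (2 ^ (2 * J)) (by positivity) fun p hp => ?_).trans
        (Real.exp_le_exp.2 ?_)
    · have := (not_le.1 (mem_filter.1 hp).2).le
      exact_mod_cast this
    · rw [div_le_one (by positivity)]
      have h3 := (card_le_card (filter_subset (fun p => ¬ p ≤ 2 ^ (2 * J)) Q)).trans
        (card_le_sq_of_orderOf_le Q hQ _ hJ)
      rw [← pow_mul, mul_comm J 2] at h3
      exact_mod_cast h3
  rw [← prod_filter_mul_prod_filter_not Q (fun p => p ≤ 2 ^ (2 * J))]
  calc _ ≤ (2 * Real.exp 8 * (2 * (J : ℝ) + 1) ^ 8) * Real.exp 1 :=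
        mul_le_mul h1 h2 (by positivity) (by positivity)
    _ = 2 * (Real.exp 8 * Real.exp 1) * (2 * (J : ℝ) + 1) ^ 8 := by ring
    _ = _ := by rw [← Real.exp_add]; norm_num

lemma exists_sum_pow_mul_geometric_le (r : ℝ) (hr0 : 0 < r) (hr1 : r < 1) :
    ∃ D : ℝ, 0 < D ∧ ∀ s : Finset ℕ, ∑ J ∈ s, (2 * ((J : ℝ) + 1) + 1) ^ 8 * r ^ J ≤ D := by
  have h1 : Summable (fun n : ℕ => (n : ℝ) ^ 8 * r ^ n) :=
    summable_pow_mul_geometric_of_norm_lt_one 8 (by rwa [Real.norm_of_nonneg hr0.le])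
  have h2 := ((summable_nat_add_iff 1).2 h1).mul_left (3 ^ 8 / r)
  have h3 : Summable (fun J : ℕ => (2 * ((J : ℝ) + 1) + 1) ^ 8 * r ^ J) := by
    refine Summable.of_nonneg_of_le (fun J => by positivity) (fun J => ?_) h2
    have e : 3 ^ 8 / r * (((J + 1 : ℕ) : ℝ) ^ 8 * r ^ (J + 1))
        = (3 * ((J : ℝ) + 1)) ^ 8 * r ^ J := by
      push_cast
      field_simp
      ring
    rw [e]
    have hJ : (0 : ℝ) ≤ J := Nat.cast_nonneg J
    gcongr
    linarith
  refine ⟨_ + 1, ?_, fun s => (h3.sum_le_tsum s fun J _ => by positivity).trans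
    (le_add_of_nonneg_right zero_le_one)⟩
  have : 0 ≤ ∑' J : ℕ, (2 * ((J : ℝ) + 1) + 1) ^ 8 * r ^ J := tsum_nonneg fun J => by positivity
  linarith

lemma coprime_two_prod (T : Finset ℕ) (hT : ∀ p ∈ T, p.Prime ∧ p ≠ 2) :
    Nat.Coprime 2 (∏ p ∈ T, p) :=
  Nat.Coprime.prod_right fun p hp =>
    (Nat.coprime_primes Nat.prime_two (hT p hp).1).2 (hT p hp).2.symm

lemma orderOf_two_dvd_of_dvd (m n : ℕ) (h : m ∣ n) :
    orderOf (2 : ZMod m) ∣ orderOf (2 : ZMod n) := by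
  have h1 := orderOf_map_dvd (ZMod.castHom h (ZMod m) : ZMod n →* ZMod m) 2
  have h2 : (ZMod.castHom h (ZMod m) : ZMod n →* ZMod m) 2 = 2 :=
    map_ofNat (ZMod.castHom h (ZMod m)) 2
  rwa [h2] at h1

lemma rpow_neg_le_pow_of_le (δ : ℝ) (hδ : 0 < δ) (e J : ℕ) (h : 2 ^ J ≤ e) :
    (e : ℝ) ^ (-δ) ≤ ((2 : ℝ) ^ (-δ)) ^ J := by
  have h1 : ((2 : ℝ) ^ J) ≤ e := by exact_mod_cast h
  have h2 := Real.rpow_le_rpow_of_nonpos (by positivity) h1 (by linarith : -δ ≤ 0)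
  refine h2.trans (le_of_eq ?_)
  rw [← Real.rpow_natCast, ← Real.rpow_natCast, ← Real.rpow_mul (by norm_num),
    ← Real.rpow_mul (by norm_num), mul_comm]

/-- The sum of `d⁻¹ e(d) ^ (-δ)` over odd squarefree `d` is bounded, where `e(d)` is the
order of `2` modulo `d`. -/
lemma exists_sum_orderOf_rpow_le (δ : ℝ) (hδ : 0 < δ) :
    ∃ C : ℝ, 0 < C ∧ ∀ Q : Finset ℕ, (∀ p ∈ Q, p.Prime ∧ p ≠ 2) →
      ∑ T ∈ Q.powerset, (∏ p ∈ T, (1 / p : ℝ)) *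
        (orderOf (2 : ZMod (∏ p ∈ T, p)) : ℝ) ^ (-δ) ≤ C := by
  have hr0 : (0 : ℝ) < 2 ^ (-δ) := by positivity
  have hr1 : (2 : ℝ) ^ (-δ) < 1 := Real.rpow_lt_one_of_one_lt_of_neg (by norm_num) (by linarith)
  obtain ⟨D, hD0, hD⟩ := exists_sum_pow_mul_geometric_le _ hr0 hr1
  refine ⟨2 * Real.exp 9 * D, by positivity, fun Q hQ => ?_⟩
  set e : Finset ℕ → ℕ := fun T => orderOf (2 : ZMod (∏ p ∈ T, p)) with he
  have hfib : ∀ J, ∑ T ∈ Q.powerset with Nat.log 2 (e T) = J,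
      (∏ p ∈ T, (1 / p : ℝ)) * (e T : ℝ) ^ (-δ)
      ≤ 2 * Real.exp 9 * ((2 * ((J : ℝ) + 1) + 1) ^ 8 * ((2 : ℝ) ^ (-δ)) ^ J) := by
    intro J
    have h1 : ∀ T ∈ Q.powerset.filter (fun T => Nat.log 2 (e T) = J),
        0 < e T ∧ T ∈ (Q.filter (fun p => orderOf (2 : ZMod p) ≤ 2 ^ (J + 1))).powerset := by
      intro T hT
      rw [mem_filter, mem_powerset] at hT
      have hTQ : ∀ p ∈ T, p.Prime ∧ p ≠ 2 := fun p hp => hQ p (hT.1 hp)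
      have h0 : 0 < e T := orderOf_two_pos _
        (prod_ne_zero_iff.2 fun p hp => (hTQ p hp).1.ne_zero) (coprime_two_prod T hTQ)
      refine ⟨h0, mem_powerset.2 fun p hp => mem_filter.2 ⟨hT.1 hp, ?_⟩⟩
      have h2 := Nat.le_of_dvd h0 (orderOf_two_dvd_of_dvd p _ (dvd_prod_of_mem (fun p => p) hp))
      have h3 := Nat.lt_pow_succ_log_self (b := 2) (by norm_num) (e T)
      rw [hT.2] at h3
      exact h2.trans h3.le
    calc ∑ T ∈ Q.powerset with Nat.log 2 (e T) = J, (∏ p ∈ T, (1 / p : ℝ)) * (e T : ℝ) ^ (-δ)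
        ≤ ∑ T ∈ Q.powerset with Nat.log 2 (e T) = J,
          (∏ p ∈ T, (1 / p : ℝ)) * ((2 : ℝ) ^ (-δ)) ^ J := by
          refine sum_le_sum fun T hT => ?_
          refine mul_le_mul_of_nonneg_left ?_ (by positivity)
          refine rpow_neg_le_pow_of_le δ hδ _ _ ?_
          rw [← (mem_filter.1 hT).2]
          exact Nat.pow_log_le_self 2 (h1 T hT).1.ne'
      _ ≤ ∑ T ∈ (Q.filter (fun p => orderOf (2 : ZMod p) ≤ 2 ^ (J + 1))).powerset,
          (∏ p ∈ T, (1 / p : ℝ)) * ((2 : ℝ) ^ (-δ)) ^ J :=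
          sum_le_sum_of_subset_of_nonneg (fun T hT => (h1 T hT).2) fun T _ _ => by positivity
      _ = (∏ p ∈ Q.filter (fun p => orderOf (2 : ZMod p) ≤ 2 ^ (J + 1)), (1 + 1 / p : ℝ))
          * ((2 : ℝ) ^ (-δ)) ^ J := by rw [← sum_mul, prod_one_add]
      _ ≤ 2 * Real.exp 9 * (2 * ((J + 1 : ℕ) : ℝ) + 1) ^ 8 * ((2 : ℝ) ^ (-δ)) ^ J := by
          refine mul_le_mul_of_nonneg_right ?_ (by positivity)
          exact prod_le_of_orderOf_le _ (fun p hp => hQ p (mem_filter.1 hp).1) _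
            fun p hp => (mem_filter.1 hp).2
      _ = _ := by push_cast; ring
  rw [← sum_fiberwise_of_maps_to (g := fun T => Nat.log 2 (e T))
    (t := Q.powerset.image fun T => Nat.log 2 (e T))
    (fun T hT => mem_image_of_mem (fun T => Nat.log 2 (e T)) hT)]
  refine (sum_le_sum fun J _ => hfib J).trans ?_
  rw [← mul_sum]
  exact mul_le_mul_of_nonneg_left (hD _) (by positivity)

lemma exists_prod_primes_le_rpow (δ : ℝ) (hδ : 0 < δ) :
    ∃ C : ℝ, 0 < C ∧ ∀ L : ℕ, ∏ p ∈ (range (L + 1)).filter Nat.Prime, (1 + 1 / p : ℝ)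
      ≤ C * ((L : ℝ) + 1) ^ δ := by
  have hr0 : (0 : ℝ) < 2 ^ (-δ) := by positivity
  have hr1 : (2 : ℝ) ^ (-δ) < 1 := Real.rpow_lt_one_of_one_lt_of_neg (by norm_num) (by linarith)
  obtain ⟨D, hD0, hD⟩ := exists_sum_pow_mul_geometric_le _ hr0 hr1
  refine ⟨2 * Real.exp 8 * D * 2 ^ δ, by positivity, fun L => ?_⟩
  set J := Nat.log 2 L + 1 with hJ
  have hLJ : L ≤ 2 ^ J := (Nat.lt_pow_succ_log_self (by norm_num) L).le
  have hJL : (2 : ℝ) ^ J ≤ 2 * ((L : ℝ) + 1) := by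
    have : 2 ^ Nat.log 2 L ≤ L + 1 := by
      rcases Nat.eq_zero_or_pos L with rfl | h
      · simp
      · exact (Nat.pow_log_le_self 2 h.ne').trans (Nat.le_succ L)
    rw [hJ, pow_succ']
    have h2 : (2 : ℝ) ^ Nat.log 2 L ≤ L + 1 := by exact_mod_cast this
    linarith
  have h1 : ((J : ℝ) + 1) ^ 8 ≤ D * 2 ^ δ * ((L : ℝ) + 1) ^ δ := by
    have h2 := hD {J}
    rw [sum_singleton] at h2
    have h3 : ((J : ℝ) + 1) ^ 8 ≤ (2 * ((J : ℝ) + 1) + 1) ^ 8 := by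
      have hJ0 : (0 : ℝ) ≤ J := Nat.cast_nonneg J
      gcongr
      linarith
    have h4 : ((2 : ℝ) ^ (-δ)) ^ J * ((2 : ℝ) ^ J) ^ δ = 1 := by
      rw [← Real.rpow_natCast, ← Real.rpow_natCast, ← Real.rpow_mul (by norm_num),
        ← Real.rpow_mul (by norm_num), ← Real.rpow_add (by norm_num)]
      ring_nf
      simp
    have h5 : ((2 : ℝ) ^ J) ^ δ ≤ 2 ^ δ * ((L : ℝ) + 1) ^ δ := by
      rw [← Real.mul_rpow (by norm_num) (by positivity)]
      exact Real.rpow_le_rpow (by positivity) hJL hδ.le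
    calc ((J : ℝ) + 1) ^ 8 = ((J : ℝ) + 1) ^ 8 * (((2 : ℝ) ^ (-δ)) ^ J * ((2 : ℝ) ^ J) ^ δ) := by
          rw [h4, mul_one]
      _ ≤ (2 * ((J : ℝ) + 1) + 1) ^ 8 * (((2 : ℝ) ^ (-δ)) ^ J * ((2 : ℝ) ^ J) ^ δ) :=
          mul_le_mul_of_nonneg_right h3 (by positivity)
      _ = (2 * ((J : ℝ) + 1) + 1) ^ 8 * ((2 : ℝ) ^ (-δ)) ^ J * ((2 : ℝ) ^ J) ^ δ := by ring
      _ ≤ D * (2 ^ δ * ((L : ℝ) + 1) ^ δ) := mul_le_mul h2 h5 (by positivity) hD0.le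
      _ = _ := by ring
  calc ∏ p ∈ (range (L + 1)).filter Nat.Prime, (1 + 1 / p : ℝ)
      ≤ ∏ p ∈ (range (2 ^ J + 1)).filter Nat.Prime, (1 + 1 / p : ℝ) := by
        refine prod_le_prod_of_subset_of_one_le (fun p hp => ?_) (fun p _ => by positivity)
          fun p _ _ => ?_
        · rw [mem_filter, mem_range] at hp
          exact mem_filter.2 ⟨mem_range.2 (by omega), hp.2⟩
        · have : (0 : ℝ) ≤ 1 / p := by positivity
          linarith
    _ ≤ 2 * Real.exp 8 * ((J : ℝ) + 1) ^ 8 := prod_primes_le_pow J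
    _ ≤ 2 * Real.exp 8 * (D * 2 ^ δ * ((L : ℝ) + 1) ^ δ) :=
        mul_le_mul_of_nonneg_left h1 (by positivity)
    _ = _ := by ring

lemma prod_primeFactors_le (L h : ℕ) (hh0 : h ≠ 0) (hh : h < 2 ^ (L + 1)) :
    ∏ p ∈ h.primeFactors, (1 + 1 / p : ℝ) ≤ 3 / 2 * Real.exp 1 *
      ∑ T ∈ ((range (L + 1)).filter (fun p => p.Prime ∧ p ≠ 2)).powerset,
        (∏ p ∈ T, (1 / p : ℝ)) * (if ∏ p ∈ T, p ∣ h then 1 else 0) := by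
  set Q := (range (L + 1)).filter (fun p => p.Prime ∧ p ≠ 2) with hQ
  have hone : ∀ p : ℕ, (1 : ℝ) ≤ 1 + 1 / p := fun p => by
    have : (0 : ℝ) ≤ 1 / p := by positivity
    linarith
  have h1 : ∏ p ∈ h.primeFactors.filter (fun p => ¬ p ≤ L), (1 + 1 / p : ℝ) ≤ Real.exp 1 := by
    refine (prod_one_add_one_div_le_exp _ ((L : ℝ) + 1) (by positivity) fun p hp => ?_).trans
        (Real.exp_le_exp.2 ?_)
    · have : L + 1 ≤ p := not_le.1 (mem_filter.1 hp).2
      exact_mod_cast this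
    · rw [div_le_one (by positivity)]
      have h2 := (card_le_card (filter_subset (fun p => ¬ p ≤ L) h.primeFactors)).trans
        (card_primeFactors_le_log h)
      have h3 : Nat.log 2 h < L + 1 := Nat.log_lt_of_lt_pow hh0 hh
      exact_mod_cast h2.trans h3.le
  have h2 : ∏ p ∈ h.primeFactors.filter (fun p => p ≤ L), (1 + 1 / p : ℝ)
      ≤ 3 / 2 * ∏ p ∈ Q.filter (fun p => p ∣ h), (1 + 1 / p : ℝ) := by
    calc ∏ p ∈ h.primeFactors.filter (fun p => p ≤ L), (1 + 1 / p : ℝ)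
        ≤ ∏ p ∈ insert 2 (Q.filter (fun p => p ∣ h)), (1 + 1 / p : ℝ) := by
          refine prod_le_prod_of_subset_of_one_le (fun p hp => ?_) (fun p _ => by positivity)
            fun p _ _ => hone p
          rw [mem_filter, Nat.mem_primeFactors] at hp
          by_cases hp2 : p = 2
          · exact mem_insert.2 (Or.inl hp2)
          · exact mem_insert_of_mem (mem_filter.2 ⟨mem_filter.2
              ⟨mem_range.2 (by omega), hp.1.1, hp2⟩, hp.1.2.1⟩)
      _ = 3 / 2 * ∏ p ∈ Q.filter (fun p => p ∣ h), (1 + 1 / p : ℝ) := by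
          rw [prod_insert (by simp [hQ])]
          norm_num
  have h3 : ∏ p ∈ Q.filter (fun p => p ∣ h), (1 + 1 / p : ℝ)
      ≤ ∑ T ∈ Q.powerset, (∏ p ∈ T, (1 / p : ℝ)) * (if ∏ p ∈ T, p ∣ h then 1 else 0) := by
    rw [prod_one_add]
    refine sum_le_sum_of_injOn _ _ _ _ id (fun T hT => ?_) Function.injective_id.injOn
      (fun T hT => ?_) fun T _ => by positivity
    · exact mem_powerset.2 ((mem_powerset.1 hT).trans (filter_subset _ _))
    · have hT' := mem_powerset.1 hT
      have : ∏ p ∈ T, p ∣ h := by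
        refine Finset.prod_primes_dvd _ (fun p hp => ?_) fun p hp => (mem_filter.1 (hT' hp)).2
        exact (mem_filter.1 (mem_filter.1 (hT' hp)).1).2.1.prime
      rw [id, if_pos this, mul_one]
  rw [← prod_filter_mul_prod_filter_not h.primeFactors (fun p => p ≤ L)]
  calc _ ≤ (3 / 2 * ∏ p ∈ Q.filter (fun p => p ∣ h), (1 + 1 / p : ℝ)) * Real.exp 1 :=
        mul_le_mul h2 h1 (by positivity) (by positivity)
    _ = 3 / 2 * Real.exp 1 * ∏ p ∈ Q.filter (fun p => p ∣ h), (1 + 1 / p : ℝ) := by ring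
    _ ≤ _ := mul_le_mul_of_nonneg_left h3 (by positivity)

lemma two_pow_eq_iff_modEq (d : ℕ) (hd : Nat.Coprime 2 d) (a b : ℕ) :
    (2 : ZMod d) ^ a = 2 ^ b ↔ a ≡ b [MOD orderOf (2 : ZMod d)] := by
  have h : ((ZMod.unitOfCoprime 2 hd : (ZMod d)ˣ) : ZMod d) = 2 := ZMod.coe_unitOfCoprime 2 hd
  rw [← h, orderOf_units, ← pow_eq_pow_iff_modEq, ← Units.val_pow_eq_pow_val,
    ← Units.val_pow_eq_pow_val, Units.val_inj]

lemma card_box_filter_le {s : ℕ} (E : Fin s → ℕ → ℕ) (K : Fin s → ℕ) (i₀ : Fin s) (d : ℕ)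
    (hd : Nat.Coprime 2 d) (M : ℝ)
    (hM : ∀ b, (((Icc 1 (K i₀)).filter
      (fun k => E i₀ k ≡ b [MOD orderOf (2 : ZMod d)])).card : ℝ) ≤ M) (c : ZMod d) :
    (K i₀ : ℝ) * (((Fintype.piFinset fun i => Icc 1 (K i)).filter
      (fun k => ((∑ i, 2 ^ E i (k i) : ℕ) : ZMod d) = c)).card : ℝ) ≤ (∏ i, (K i : ℝ)) * M := by
  set S := (Fintype.piFinset fun i => Icc 1 (K i)).filter
      (fun k => ((∑ i, 2 ^ E i (k i) : ℕ) : ZMod d) = c) with hS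
  set f : (Fin s → ℕ) → (Fin s → ℕ) := fun k => Function.update k i₀ 0 with hf
  have hM0 : 0 ≤ M := (Nat.cast_nonneg _).trans (hM 0)
  have hfib : ∀ g ∈ S.image f, ((S.filter (fun k => f k = g)).card : ℝ) ≤ M := by
    intro g hg
    obtain ⟨k₀, hk₀, rfl⟩ := mem_image.1 hg
    refine le_trans ?_ (hM (E i₀ (k₀ i₀)))
    norm_cast
    refine card_le_card_of_injOn (fun k => k i₀) ?_ ?_
    · intro k hk
      simp only [coe_filter, Set.mem_ofPred_eq, hS, mem_filter, Fintype.mem_piFinset] at hk hk₀ ⊢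
      refine ⟨hk.1.1 i₀, (two_pow_eq_iff_modEq d hd _ _).1 ?_⟩
      have h1 := hk.1.2.trans hk₀.2.symm
      rw [Fintype.sum_eq_add_sum_compl i₀, Fintype.sum_eq_add_sum_compl i₀] at h1
      have h2 : ∑ i ∈ {i₀}ᶜ, 2 ^ E i (k i) = ∑ i ∈ {i₀}ᶜ, 2 ^ E i (k₀ i) := by
        refine sum_congr rfl fun i hi => ?_
        have hne : i ≠ i₀ := by simpa using hi
        have := congrFun hk.2 i
        simp only [hf, Function.update_of_ne hne] at this
        rw [this]
      rw [h2] at h1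
      push_cast at h1
      exact add_right_cancel h1
    · intro k hk k' hk' hkk
      simp only [coe_filter, Set.mem_ofPred_eq] at hk hk'
      have h1 := hk.2.trans hk'.2.symm
      funext i
      by_cases hi : i = i₀
      · subst hi; exact hkk
      · have := congrFun h1 i
        simpa only [hf, Function.update_of_ne hi] using this
  have himg : (S.image f).card ≤ ∏ i ∈ {i₀}ᶜ, K i := by
    calc (S.image f).card
        ≤ (Fintype.piFinset (fun i => if i = i₀ then {0} else Icc 1 (K i))).card := by
          refine card_le_card fun g hg => ?_
          obtain ⟨k, hk, rfl⟩ := mem_image.1 hg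
          rw [Fintype.mem_piFinset]
          intro i
          by_cases hi : i = i₀
          · subst hi; simp [hf]
          · rw [if_neg hi, hf]
            simp only [Function.update_of_ne hi]
            exact Fintype.mem_piFinset.1 (mem_filter.1 hk).1 i
      _ = ∏ i ∈ {i₀}ᶜ, K i := by
          rw [Fintype.card_piFinset, Fintype.prod_eq_mul_prod_compl i₀]
          rw [if_pos rfl, card_singleton, one_mul]
          refine prod_congr rfl fun i hi => ?_
          have hne : i ≠ i₀ := by simpa using hi
          rw [if_neg hne, Nat.card_Icc, Nat.add_sub_cancel]
  have hcard : (S.card : ℝ) ≤ (S.image f).card * M := by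
    rw [card_eq_sum_card_image f S]
    push_cast
    calc _ ≤ ∑ _g ∈ S.image f, M := sum_le_sum hfib
      _ = _ := by rw [sum_const, nsmul_eq_mul]
  have himg' : ((S.image f).card : ℝ) ≤ ∏ i ∈ {i₀}ᶜ, (K i : ℝ) := by exact_mod_cast himg
  rw [Fintype.prod_eq_mul_prod_compl i₀, mul_assoc]
  exact mul_le_mul_of_nonneg_left
    (hcard.trans (mul_le_mul_of_nonneg_right himg' hM0)) (Nat.cast_nonneg _)

lemma exists_sum_prod_primeFactors_le {s : ℕ} (E : Fin s → ℕ → ℕ) (ρ : Fin s → ℝ) (i₀ : Fin s)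
    (hρ : ∑ i, ρ i = 1) (hρ0 : 0 < ρ i₀)
    (hE : ∃ C : ℝ, 0 < C ∧ ∃ δ : ℝ, 0 < δ ∧ ∀ K m b : ℕ, 1 ≤ K → 1 ≤ m →
      (((Icc 1 K).filter (fun k => E i₀ k ≡ b [MOD m])).card : ℝ)
        ≤ C * K * ((m : ℝ) ^ (-δ) + (K : ℝ) ^ (-δ))) :
    ∃ C : ℝ, 0 < C ∧ ∀ (L : ℕ) (B : Finset (Fin s → ℕ)),
      B = Fintype.piFinset (fun i => Icc 1 ⌊2 * ((L : ℝ) + 1) ^ ρ i⌋₊) →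
      ∑ x ∈ (B ×ˢ B).filter (fun x => ∑ i, 2 ^ E i (x.1 i) < ∑ i, 2 ^ E i (x.2 i) ∧
          ∑ i, 2 ^ E i (x.2 i) < 2 ^ (L + 1)),
        ∏ p ∈ Nat.primeFactors (∑ i, 2 ^ E i (x.2 i) - ∑ i, 2 ^ E i (x.1 i)), (1 + 1 / p : ℝ)
      ≤ C * ((L : ℝ) + 1) ^ 2 := by
  obtain ⟨C, hC, δ, hδ, hE⟩ := hE
  obtain ⟨C₁, hC₁, hsum⟩ := exists_sum_orderOf_rpow_le δ hδ
  obtain ⟨C₂, hC₂, hprod⟩ := exists_prod_primes_le_rpow (ρ i₀ * δ) (by positivity)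
  refine ⟨3 / 2 * Real.exp 1 * (4 ^ s * (C * (C₁ + C₂))), by positivity, fun L B hB => ?_⟩
  set a : (Fin s → ℕ) → ℕ := fun k => ∑ i, 2 ^ E i (k i) with ha
  set K : Fin s → ℕ := fun i => ⌊2 * ((L : ℝ) + 1) ^ ρ i⌋₊ with hK
  set F := (B ×ˢ B).filter (fun x => a x.1 < a x.2 ∧ a x.2 < 2 ^ (L + 1)) with hF
  set Q := (range (L + 1)).filter (fun p => p.Prime ∧ p ≠ 2) with hQ
  have hQ2 : ∀ p ∈ Q, p.Prime ∧ p ≠ 2 := fun p hp => (mem_filter.1 hp).2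
  have hL1 : (1 : ℝ) ≤ (L : ℝ) + 1 := by linarith [(Nat.cast_nonneg L : (0 : ℝ) ≤ L)]
  set P : ℝ := ∏ i, (K i : ℝ) with hP
  have hP0 : 0 ≤ P := prod_nonneg fun i _ => Nat.cast_nonneg _
  have hPle : P ≤ 2 ^ s * ((L : ℝ) + 1) := by
    calc P ≤ ∏ i, (2 * ((L : ℝ) + 1) ^ ρ i) :=
          prod_le_prod (fun i _ => Nat.cast_nonneg _) fun i _ => Nat.floor_le (by positivity)
      _ = 2 ^ s * ((L : ℝ) + 1) := by
          rw [prod_mul_distrib, prod_const, card_univ, Fintype.card_fin,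
            ← Real.rpow_sum_of_pos (by linarith), hρ, Real.rpow_one]
  have hBcard : (B.card : ℝ) = P := by
    rw [hB, Fintype.card_piFinset]
    simp only [Nat.card_Icc, Nat.add_sub_cancel]
    push_cast
    rfl
  have hK0 : ((L : ℝ) + 1) ^ ρ i₀ ≤ K i₀ := by
    have h1 : (1 : ℝ) ≤ ((L : ℝ) + 1) ^ ρ i₀ := Real.one_le_rpow hL1 hρ0.le
    have h2 := Nat.lt_floor_add_one (2 * ((L : ℝ) + 1) ^ ρ i₀)
    have h3 : ((⌊2 * ((L : ℝ) + 1) ^ ρ i₀⌋₊ : ℕ) : ℝ) = K i₀ := rfl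
    linarith
  have hK1 : 1 ≤ K i₀ := by
    have := (Real.one_le_rpow hL1 hρ0.le).trans hK0
    exact_mod_cast this
  have hKpos : (0 : ℝ) < K i₀ := by exact_mod_cast hK1
  have hKδ : (K i₀ : ℝ) ^ (-δ) * (((L : ℝ) + 1) ^ (ρ i₀ * δ)) ≤ 1 := by
    have h1 := Real.rpow_le_rpow_of_nonpos (by positivity) hK0 (by linarith : -δ ≤ 0)
    rw [← Real.rpow_mul (by positivity)] at h1
    calc _ ≤ ((L : ℝ) + 1) ^ (ρ i₀ * -δ) * ((L : ℝ) + 1) ^ (ρ i₀ * δ) :=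
          mul_le_mul_of_nonneg_right h1 (by positivity)
      _ = 1 := by
          rw [← Real.rpow_add (by linarith)]
          ring_nf
          exact Real.rpow_zero _
  have hcount : ∀ T ∈ Q.powerset, ∑ x ∈ F, (if ∏ p ∈ T, p ∣ a x.2 - a x.1 then (1 : ℝ) else 0)
      ≤ P ^ 2 * (C * ((orderOf (2 : ZMod (∏ p ∈ T, p)) : ℝ) ^ (-δ) + (K i₀ : ℝ) ^ (-δ))) := by
    intro T hT
    have hTQ : ∀ p ∈ T, p.Prime ∧ p ≠ 2 := fun p hp => hQ2 p (mem_powerset.1 hT hp)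
    set d := ∏ p ∈ T, p with hd
    have hcop := coprime_two_prod T hTQ
    have he : 1 ≤ orderOf (2 : ZMod d) := orderOf_two_pos _
        (prod_ne_zero_iff.2 fun p hp => (hTQ p hp).1.ne_zero) hcop
    set R := C * ((orderOf (2 : ZMod d) : ℝ) ^ (-δ) + (K i₀ : ℝ) ^ (-δ)) with hR
    have h1 : ∀ c : ZMod d, ((B.filter (fun k => ((a k : ℕ) : ZMod d) = c)).card : ℝ) ≤ P * R := by
      intro c
      have h2 := card_box_filter_le E K i₀ d hcop (C * K i₀ *
        ((orderOf (2 : ZMod d) : ℝ) ^ (-δ) + (K i₀ : ℝ) ^ (-δ)))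
        (fun b => hE (K i₀) _ b hK1 he) c
      rw [← hB] at h2
      refine le_of_mul_le_mul_left (h2.trans (le_of_eq ?_)) hKpos
      rw [hR]
      ring
    calc ∑ x ∈ F, (if d ∣ a x.2 - a x.1 then (1 : ℝ) else 0)
        ≤ ∑ x ∈ F, (if ((a x.1 : ℕ) : ZMod d) = a x.2 then (1 : ℝ) else 0) := by
          refine sum_le_sum fun x hx => ?_
          have hx' := (mem_filter.1 hx).2.1
          split_ifs with h3 h4
          · exact le_rfl
          · exact absurd ((ZMod.natCast_eq_natCast_iff _ _ d).2
              ((Nat.modEq_iff_dvd' hx'.le).2 h3)) h4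
          · exact zero_le_one
          · exact le_rfl
      _ ≤ ∑ x ∈ B ×ˢ B, (if ((a x.1 : ℕ) : ZMod d) = a x.2 then (1 : ℝ) else 0) :=
          sum_le_sum_of_subset_of_nonneg (filter_subset _ _) fun x _ _ => by positivity
      _ = ∑ k' ∈ B, ((B.filter (fun k => ((a k : ℕ) : ZMod d) = a k')).card : ℝ) := by
          rw [sum_product_right]
          exact sum_congr rfl fun k' _ => sum_boole _ _
      _ ≤ ∑ _k' ∈ B, P * R := sum_le_sum fun k' _ => h1 _
      _ = P ^ 2 * R := by rw [sum_const, nsmul_eq_mul, hBcard]; ring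
  calc ∑ x ∈ F, ∏ p ∈ (a x.2 - a x.1).primeFactors, (1 + 1 / p : ℝ)
      ≤ ∑ x ∈ F, 3 / 2 * Real.exp 1 * ∑ T ∈ Q.powerset,
        (∏ p ∈ T, (1 / p : ℝ)) * (if ∏ p ∈ T, p ∣ a x.2 - a x.1 then 1 else 0) := by
        refine sum_le_sum fun x hx => ?_
        have hx' := (mem_filter.1 hx).2
        exact prod_primeFactors_le L _ (Nat.sub_ne_zero_of_lt hx'.1)
          ((Nat.sub_le _ _).trans_lt hx'.2)
    _ = 3 / 2 * Real.exp 1 * ∑ T ∈ Q.powerset, (∏ p ∈ T, (1 / p : ℝ)) *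
        ∑ x ∈ F, (if ∏ p ∈ T, p ∣ a x.2 - a x.1 then (1 : ℝ) else 0) := by
        rw [← mul_sum, sum_comm]
        simp only [mul_sum]
    _ ≤ 3 / 2 * Real.exp 1 * ∑ T ∈ Q.powerset, (∏ p ∈ T, (1 / p : ℝ)) *
        (P ^ 2 * (C * ((orderOf (2 : ZMod (∏ p ∈ T, p)) : ℝ) ^ (-δ) + (K i₀ : ℝ) ^ (-δ)))) := by
        refine mul_le_mul_of_nonneg_left (sum_le_sum fun T hT => ?_) (by positivity)
        exact mul_le_mul_of_nonneg_left (hcount T hT) (by positivity)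
    _ = 3 / 2 * Real.exp 1 * (P ^ 2 * (C * (∑ T ∈ Q.powerset, (∏ p ∈ T, (1 / p : ℝ)) *
          (orderOf (2 : ZMod (∏ p ∈ T, p)) : ℝ) ^ (-δ)
          + (K i₀ : ℝ) ^ (-δ) * ∏ p ∈ Q, (1 + 1 / p : ℝ)))) := by
        rw [prod_one_add]
        simp only [mul_add, sum_add_distrib, mul_sum]
        congr 1 <;> exact sum_congr rfl fun T _ => by ring
    _ ≤ 3 / 2 * Real.exp 1 * ((2 ^ s * ((L : ℝ) + 1)) ^ 2 * (C * (C₁ + C₂))) := by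
        have h5 : (K i₀ : ℝ) ^ (-δ) * ∏ p ∈ Q, (1 + 1 / p : ℝ) ≤ C₂ := by
          calc (K i₀ : ℝ) ^ (-δ) * ∏ p ∈ Q, (1 + 1 / p : ℝ)
              ≤ (K i₀ : ℝ) ^ (-δ) * (C₂ * ((L : ℝ) + 1) ^ (ρ i₀ * δ)) := by
                refine mul_le_mul_of_nonneg_left (le_trans ?_ (hprod L)) (by positivity)
                refine prod_le_prod_of_subset_of_one_le (fun p hp => ?_)
                  (fun p _ => by positivity) fun p _ _ => ?_
                · rw [hQ, mem_filter] at hp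
                  exact mem_filter.2 ⟨hp.1, hp.2.1⟩
                · have : (0 : ℝ) ≤ 1 / p := by positivity
                  linarith
            _ = C₂ * ((K i₀ : ℝ) ^ (-δ) * ((L : ℝ) + 1) ^ (ρ i₀ * δ)) := by ring
            _ ≤ C₂ * 1 := mul_le_mul_of_nonneg_left hKδ hC₂.le
            _ = C₂ := mul_one _
        have h6 := mul_le_mul_of_nonneg_left (add_le_add (hsum Q hQ2) h5) hC.le
        refine mul_le_mul_of_nonneg_left ?_ (by positivity)
        exact mul_le_mul (pow_le_pow_left₀ hP0 hPle 2) h6 (by positivity) (by positivity)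
    _ = _ := by
        have : (4 : ℝ) ^ s = (2 ^ s) ^ 2 := by rw [← pow_mul, mul_comm, pow_mul]; norm_num
        rw [this]
        ring

lemma exists_ncard_prime_pairs_le {s : ℕ} (E : Fin s → ℕ → ℕ) (ρ : Fin s → ℝ) (i₀ : Fin s)
    (hρ : ∑ i, ρ i = 1) (hρ0 : 0 < ρ i₀)
    (hE : ∃ C : ℝ, 0 < C ∧ ∃ δ : ℝ, 0 < δ ∧ ∀ K m b : ℕ, 1 ≤ K → 1 ≤ m →
      (((Icc 1 K).filter (fun k => E i₀ k ≡ b [MOD m])).card : ℝ)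
        ≤ C * K * ((m : ℝ) ^ (-δ) + (K : ℝ) ^ (-δ)))
    (hEρ : ∀ i k L, 1 ≤ k → E i k ≤ L → (k : ℝ) ≤ 2 * ((L : ℝ) + 1) ^ ρ i)
    (A : Set ℕ) (hA : ∀ n ∈ A, ∃ k : Fin s → ℕ, (∀ i, 1 ≤ k i) ∧ n = ∑ i, 2 ^ E i (k i)) :
    ∃ C : ℝ, 0 < C ∧ ∀ X : ℕ, 2 ≤ X →
      (({q : ℕ × ℕ × ℕ × ℕ | q.1 ∈ A ∧ q.2.1 ∈ A ∧ q.1 < q.2.1 ∧ q.2.1 ≤ X ∧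
        q.2.2.1.Prime ∧ q.2.2.2.Prime ∧ q.2.2.2 < q.2.2.1 ∧ q.2.2.1 ≤ X ∧
        (q.2.2.1 : ℤ) - (q.2.2.2 : ℤ) = (q.2.1 : ℤ) - (q.1 : ℤ)} :
          Set (ℕ × ℕ × ℕ × ℕ)).ncard : ℝ) ≤ C * X := by
  obtain ⟨C, hC, hCs⟩ := exists_sum_prod_primeFactors_le E ρ i₀ hρ hρ0 hE
  refine ⟨160000 * C, by positivity, fun X hX => ?_⟩
  set L := Nat.log 2 X with hL
  have hXL : X < 2 ^ (L + 1) := Nat.lt_pow_succ_log_self (by norm_num) X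
  have hLX : 2 ^ L ≤ X := Nat.pow_log_le_self 2 (by omega)
  set B := Fintype.piFinset (fun i => Icc 1 ⌊2 * ((L : ℝ) + 1) ^ ρ i⌋₊) with hB
  have hsum := hCs L B hB
  set a : (Fin s → ℕ) → ℕ := fun k => ∑ i, 2 ^ E i (k i) with ha
  set F := (B ×ˢ B).filter (fun x => a x.1 < a x.2 ∧ a x.2 < 2 ^ (L + 1)) with hF
  have hbox : ∀ k : Fin s → ℕ, (∀ i, 1 ≤ k i) → a k ≤ X → k ∈ B := by
    intro k hk hkX
    rw [hB, Fintype.mem_piFinset]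
    intro i
    refine Finset.mem_Icc.2 ⟨hk i, Nat.le_floor (hEρ i (k i) L (hk i) ?_)⟩
    refine Nat.le_log_of_pow_le (by norm_num) (le_trans ?_ hkX)
    exact single_le_sum (f := fun i => 2 ^ E i (k i)) (fun _ _ => Nat.zero_le _) (mem_univ i)
  set W := F.sigma (fun x => (range (X + 1)).filter
    (fun n => n.Prime ∧ (n + (a x.2 - a x.1)).Prime)) with hW
  set g : ((_ : (Fin s → ℕ) × (Fin s → ℕ)) × ℕ) → ℕ × ℕ × ℕ × ℕ :=
    fun w => (a w.1.1, a w.1.2, w.2 + (a w.1.2 - a w.1.1), w.2) with hg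
  have hsub : {q : ℕ × ℕ × ℕ × ℕ | q.1 ∈ A ∧ q.2.1 ∈ A ∧ q.1 < q.2.1 ∧ q.2.1 ≤ X ∧
        q.2.2.1.Prime ∧ q.2.2.2.Prime ∧ q.2.2.2 < q.2.2.1 ∧ q.2.2.1 ≤ X ∧
        (q.2.2.1 : ℤ) - (q.2.2.2 : ℤ) = (q.2.1 : ℤ) - (q.1 : ℤ)} ⊆ (W.image g : Set _) := by
    rintro ⟨a₁, a₂, p₁, p₂⟩ ⟨h1, h2, h3, h4, h5, h6, h7, h8, h9⟩
    dsimp only at h1 h2 h3 h4 h5 h6 h7 h8 h9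
    obtain ⟨k, hk, hka⟩ := hA a₁ h1
    obtain ⟨k', hk', hka'⟩ := hA a₂ h2
    change a₁ = a k at hka
    change a₂ = a k' at hka'
    have hp : p₂ + (a₂ - a₁) = p₁ := by omega
    rw [coe_image]
    refine ⟨⟨(k, k'), p₂⟩, ?_, ?_⟩
    · rw [mem_coe, hW, mem_sigma]
      refine ⟨mem_filter.2 ⟨mem_product.2 ⟨hbox k hk (by rw [← hka]; omega),
        hbox k' hk' (by rw [← hka']; omega)⟩, ?_, ?_⟩,
        mem_filter.2 ⟨mem_range.2 (show p₂ < X + 1 by omega), h6, ?_⟩⟩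
      · dsimp only
        rw [← hka, ← hka']
        exact h3
      · dsimp only
        rw [← hka']
        exact h4.trans_lt hXL
      · dsimp only
        rw [← hka, ← hka', hp]
        exact h5
    · rw [hg]
      dsimp only
      rw [← hka, ← hka', hp]
  have hXr : (2 : ℝ) ≤ X := by exact_mod_cast hX
  have hlogX : 0 < Real.log X := Real.log_pos (by linarith)
  have hLlog : (L : ℝ) + 1 ≤ 4 * Real.log X := by
    have h1 : Real.log 2 ≤ Real.log X := Real.log_le_log (by norm_num) hXr
    have h2 : L * Real.log 2 ≤ Real.log X := by
      rw [← Real.log_pow]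
      exact Real.log_le_log (by positivity) (by exact_mod_cast hLX)
    have h3 := Real.log_two_gt_d9
    have h4 : (0 : ℝ) ≤ L := Nat.cast_nonneg L
    nlinarith
  have hcard : W.card = ∑ x ∈ F, ((range (X + 1)).filter
    (fun n => n.Prime ∧ (n + (a x.2 - a x.1)).Prime)).card := card_sigma _ _
  have h0 : 0 ≤ 10000 * X / Real.log X ^ 2 := by positivity
  calc _ ≤ (W.card : ℝ) := by
        have h1 := (Set.ncard_le_ncard hsub (finite_toSet _)).trans
          ((Set.ncard_coe_finset _).le.trans card_image_le)
        exact_mod_cast h1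
    _ ≤ ∑ x ∈ F, 10000 * X / Real.log X ^ 2 *
          ∏ p ∈ (a x.2 - a x.1).primeFactors, (1 + 1 / p : ℝ) := by
        rw [hcard]
        push_cast
        refine sum_le_sum fun x hx => card_twin_le X _ hX ?_
        exact Nat.sub_ne_zero_of_lt (mem_filter.1 hx).2.1
    _ ≤ 10000 * X / Real.log X ^ 2 * (C * ((L : ℝ) + 1) ^ 2) := by
        rw [← mul_sum]
        exact mul_le_mul_of_nonneg_left hsum h0
    _ ≤ 10000 * X / Real.log X ^ 2 * (C * (4 * Real.log X) ^ 2) := by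
        refine mul_le_mul_of_nonneg_left (mul_le_mul_of_nonneg_left ?_ hC.le) h0
        exact pow_le_pow_left₀ (by positivity) hLlog 2
    _ = 160000 * C * X := by
        field_simp
        norm_num

lemma sum_fin_ite_last {M : Type*} [AddCommMonoid M] (s : ℕ) (hs : 0 < s) (f g : Fin s → M) :
    ∑ i : Fin s, (if (i : ℕ) < s - 1 then f i else g i)
      = ∑ i ∈ univ.filter (fun i : Fin s => (i : ℕ) < s - 1), f i + g ⟨s - 1, by omega⟩ := by
  have h : univ.filter (fun i : Fin s => ¬ (i : ℕ) < s - 1) = {⟨s - 1, by omega⟩} := by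
    ext i
    simp only [mem_filter, mem_univ, true_and, mem_singleton, Fin.ext_iff]
    omega
  rw [sum_ite, h, sum_singleton]

lemma le_rpow_inv_of_floor_rpow_le (y r : ℝ) (hy : 0 ≤ y) (hr : 0 < r) (L : ℕ)
    (h : ⌊y ^ r⌋₊ ≤ L) : y ≤ ((L : ℝ) + 1) ^ r⁻¹ := by
  have h1 : y ^ r ≤ (L : ℝ) + 1 := by
    have h2 : (⌊y ^ r⌋₊ : ℝ) ≤ L := by exact_mod_cast h
    linarith [Nat.lt_floor_add_one (y ^ r)]
  exact (Real.le_rpow_inv_iff_of_pos hy (by positivity) hr).2 h1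

lemma le_two_mul_rpow_inv_of_floor_floor_rpow_le (lam r : ℝ) (hlam : 1 ≤ lam) (hr : 0 < r)
    (k L : ℕ) (hk : 1 ≤ k) (h : ⌊((⌊(k : ℝ) ^ lam⌋₊ : ℕ) : ℝ) ^ r⌋₊ ≤ L) :
    (k : ℝ) ≤ 2 * ((L : ℝ) + 1) ^ (lam * r)⁻¹ := by
  have hlam0 : 0 < lam := by linarith
  have h1 := le_rpow_inv_of_floor_rpow_le _ r (Nat.cast_nonneg _) hr L h
  have hk1 : (1 : ℝ) ≤ (k : ℝ) ^ lam := Real.one_le_rpow (by exact_mod_cast hk) (by linarith)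
  have h2 : (1 : ℝ) ≤ (⌊(k : ℝ) ^ lam⌋₊ : ℕ) := by
    exact_mod_cast Nat.le_floor (by exact_mod_cast hk1)
  have h3 : (k : ℝ) ^ lam ≤ 2 * ((L : ℝ) + 1) ^ r⁻¹ := by
    linarith [Nat.lt_floor_add_one ((k : ℝ) ^ lam)]
  have h4 := (Real.le_rpow_inv_iff_of_pos (Nat.cast_nonneg k) (by positivity) hlam0).2 h3
  rw [Real.mul_rpow (by norm_num) (by positivity), ← Real.rpow_mul (by positivity)] at h4
  have h5 : (2 : ℝ) ^ lam⁻¹ ≤ 2 := by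
    calc (2 : ℝ) ^ lam⁻¹ ≤ 2 ^ (1 : ℝ) :=
          Real.rpow_le_rpow_of_exponent_le (by norm_num) (inv_le_one_of_one_le₀ hlam)
      _ = 2 := Real.rpow_one 2
  rw [mul_inv, mul_comm lam⁻¹]
  exact h4.trans (mul_le_mul_of_nonneg_right h5 (by positivity))

end

/-- `S(x) ≪ x`, where `S(x)` counts quadruples `(a₁, a₂, p₁, p₂)` with
`a₁, a₂ ∈ A`, `a₁ < a₂ ≤ x`, `p₁, p₂` prime, `p₂ < p₁ ≤ x` and `p₁ − p₂ = a₂ − a₁`. -/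
theorem romA_S_upper (s : ℕ) (hs : 2 ≤ s) (r : Fin s → ℝ) (hr : ∀ i, 1 < r i)
    (hri : ∀ i, ∀ m : ℤ, r i ≠ m) (lam : ℝ) (hlam : 1 ≤ lam)
    (hsum : (∑ i ∈ Finset.univ.filter (fun i : Fin s => (i : ℕ) < s - 1), (r i)⁻¹)
      + (lam * r ⟨s - 1, by omega⟩)⁻¹ = 1) :
    ∃ C > (0 : ℝ), ∃ x₀ : ℝ, ∀ x : ℝ, x₀ ≤ x →
      (({q : ℕ × ℕ × ℕ × ℕ | q.1 ∈ romA s (by omega) r lam ∧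
        q.2.1 ∈ romA s (by omega) r lam ∧ q.1 < q.2.1 ∧ ((q.2.1 : ℕ) : ℝ) ≤ x ∧
        q.2.2.1.Prime ∧ q.2.2.2.Prime ∧ q.2.2.2 < q.2.2.1 ∧ ((q.2.2.1 : ℕ) : ℝ) ≤ x ∧
        (q.2.2.1 : ℤ) - (q.2.2.2 : ℤ) = (q.2.1 : ℤ) - (q.1 : ℤ)} :
          Set (ℕ × ℕ × ℕ × ℕ)).ncard : ℝ) ≤ C * x := by
  have hs1 : 0 < s - 1 := by omega
  let E : Fin s → ℕ → ℕ := fun i k =>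
    if (i : ℕ) < s - 1 then ⌊(k : ℝ) ^ r i⌋₊ else ⌊((⌊(k : ℝ) ^ lam⌋₊ : ℕ) : ℝ) ^ r i⌋₊
  let ρ : Fin s → ℝ := fun i => if (i : ℕ) < s - 1 then (r i)⁻¹ else (lam * r i)⁻¹
  have hr0 : ∀ i, 0 < r i := fun i => zero_lt_one.trans (hr i)
  obtain ⟨C, hC, H⟩ := exists_ncard_prime_pairs_le E ρ ⟨0, by omega⟩
    ((sum_fin_ite_last s (by omega) _ _).trans hsum)
    (by simp only [ρ, if_pos hs1]; exact inv_pos.2 (hr0 _))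
    (by simpa only [E, if_pos hs1] using card_floor_rpow_modEq_le _ (hr _) (hri _))
    (by
      intro i k L hk h
      by_cases hi : (i : ℕ) < s - 1
      · simp only [E, ρ, if_pos hi] at h ⊢
        have h1 := le_rpow_inv_of_floor_rpow_le (k : ℝ) (r i) (Nat.cast_nonneg k) (hr0 i) L h
        have h2 : (0 : ℝ) ≤ ((L : ℝ) + 1) ^ (r i)⁻¹ := by positivity
        linarith
      · simp only [E, ρ, if_neg hi] at h ⊢
        exact le_two_mul_rpow_inv_of_floor_floor_rpow_le lam (r i) hlam (hr0 i) k L hk h)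
    (romA s (by omega) r lam)
    (by
      rintro n ⟨k, hk, rfl⟩
      refine ⟨k, hk, ?_⟩
      rw [← sum_fin_ite_last s (by omega) (fun i => 2 ^ ⌊(k i : ℝ) ^ r i⌋₊)
        (fun i => 2 ^ ⌊((⌊(k i : ℝ) ^ lam⌋₊ : ℕ) : ℝ) ^ r i⌋₊)]
      refine Finset.sum_congr rfl fun i _ => ?_
      simp only [E]
      split_ifs <;> rfl)
  refine ⟨C, hC, 2, fun x hx => ?_⟩
  have hx0 : 0 ≤ x := by linarith
  have hX := H ⌊x⌋₊ (Nat.le_floor (by exact_mod_cast hx))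
  simp only [Nat.le_floor_iff hx0] at hX
  exact hX.trans (mul_le_mul_of_nonneg_left (Nat.floor_le hx0) hC.le)
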